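/- arXiv:2605.00697 — 2 statements merged into one kernel-verified Lean document; each statement's English description precedes it below -/
import Mathlib

section
/- Let T = DLO, the theory of dense linear orders without endpoints in the language {<}. Then T is not D-categorical for any nonzero arithmetic degree D. -/
open FirstOrder FirstOrder.Language

namespace ArMorley

/-! ## Arithmetical sets and arithmetic reducibility -/

/-- Function symbols of the language of arithmetic: `0`, `1`, `+`, `·`. -/
inductive ArFunc : ℕ → Type
  | zero : ArFunc 0
  | one : ArFunc 0
  | add : ArFunc 2
  | mul : ArFunc 2

/-- Relation symbols: `<` and a unary oracle predicate. -/
inductive ArRel : ℕ → Type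
  | lt : ArRel 2
  | mem : ArRel 1

/-- The language `(+, ·, 0, 1, <, Y)` of arithmetic with a unary oracle predicate. -/
def arithLang : FirstOrder.Language := ⟨ArFunc, ArRel⟩

/-- The standard structure on `ℕ`, with the oracle predicate interpreted by `Y`. -/
def arithStructure (Y : Set ℕ) : arithLang.Structure ℕ where
  funMap := fun {n} f =>
    match f with
    | ArFunc.zero => fun _ => 0
    | ArFunc.one => fun _ => 1
    | ArFunc.add => fun v => v 0 + v 1
    | ArFunc.mul => fun v => v 0 * v 1
  RelMap := fun {n} r =>
    match r with
    | ArRel.lt => fun v => v 0 < v 1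
    | ArRel.mem => fun v => v 0 ∈ Y

/-- `X ≤_ar Y` : `X` is definable without parameters in `(ℕ, +, ·, 0, 1, <, Y)`. -/
def ArReducible (X Y : Set ℕ) : Prop :=
  letI := arithStructure Y
  ∃ φ : arithLang.Formula (Fin 1), X = { n : ℕ | φ.Realize (fun _ => n) }

/-- `X` is arithmetical: definable without parameters in `(ℕ, +, ·, 0, 1, <)`. -/
def IsArithmetical (X : Set ℕ) : Prop := ArReducible X ∅

/-- `X` and `Y` have the same arithmetic degree. -/
def ArEquiv (X Y : Set ℕ) : Prop := ArReducible X Y ∧ ArReducible Y X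

/-! ## Coding conventions -/

/-- Code of a list of naturals. -/
def listCode (l : List ℕ) : ℕ := Encodable.encode l

/-- Code of a finite tuple of naturals. -/
def tupleCode {n : ℕ} (v : Fin n → ℕ) : ℕ := listCode (List.ofFn v)

/-- The subset of `ℕ` corresponding to a set of elements of a coded domain. -/
def subCode {A : Set ℕ} (S : Set ↥A) : Set ℕ := Subtype.val '' S

/-- Code of a set of `n`-tuples from a coded domain as a subset of `ℕ`. -/
def tupleSetCode {A : Set ℕ} {n : ℕ} (X : Set (Fin n → ↥A)) : Set ℕ :=
  { c : ℕ | ∃ v ∈ X, c = tupleCode (fun i => ((v i : ℕ))) }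

/-- Code of the graph of a function between coded domains. -/
def graphCode {A B : Set ℕ} (f : ↥A → ↥B) : Set ℕ :=
  { c : ℕ | ∃ a : ↥A, c = Nat.pair (a : ℕ) ((f a : ℕ)) }

/-! ## Gödel coded languages -/

/-- A fixed Gödel coding of the symbols of a countable first-order language. -/
structure GoedelCoding (L : FirstOrder.Language) where
  encFun : ∀ n, L.Functions n → ℕ
  encFun_inj : ∀ n, Function.Injective (encFun n)
  encRel : ∀ n, L.Relations n → ℕ
  encRel_inj : ∀ n, Function.Injective (encRel n)

variable {L : FirstOrder.Language}

/-- The set of codes of the symbols of `L`. -/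
def symbolCodes (g : GoedelCoding L) : Set ℕ :=
  { c | (∃ (n : ℕ) (f : L.Functions n), c = Nat.pair 0 (Nat.pair n (g.encFun n f))) ∨
        (∃ (n : ℕ) (R : L.Relations n), c = Nat.pair 1 (Nat.pair n (g.encRel n R))) }

/-- `L` is an arithmetically definable language. -/
def ArithLang (g : GoedelCoding L) : Prop := IsArithmetical (symbolCodes g)

/-- Code of a term, with a given coding of the variables. -/
def termCode (g : GoedelCoding L) {α : Type} (encα : α → ℕ) (t : L.Term α) : ℕ :=
  listCode (t.listEncode.map (Sum.elim (fun a => Nat.pair 0 (encα a))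
    (fun p => Nat.pair 1 (Nat.pair p.1 (g.encFun p.1 p.2)))))

/-- Code of a (bounded) formula, with a given coding of free variables. -/
def formulaCode (g : GoedelCoding L) {α : Type} (encα : α → ℕ) {n : ℕ}
    (φ : L.BoundedFormula α n) : ℕ :=
  listCode (φ.listEncode.map (Sum.elim
    (fun p => Nat.pair 0 (Nat.pair p.1
      (termCode g (Sum.elim (fun a => Nat.pair 0 (encα a)) (fun i => Nat.pair 1 i.1)) p.2)))
    (Sum.elim
      (fun q => Nat.pair 1 (Nat.pair q.1 (g.encRel q.1 q.2)))
      (fun m => Nat.pair 2 m))))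

/-- Code of a sentence. -/
def sentenceCode (g : GoedelCoding L) (φ : L.Sentence) : ℕ :=
  formulaCode g (fun a : Empty => a.elim) φ

/-- The set of codes of the axioms of a theory. -/
def theoryCode (g : GoedelCoding L) (T : L.Theory) : Set ℕ :=
  { c | ∃ φ ∈ T, c = sentenceCode g φ }

/-- `T` is an arithmetically definable theory. -/
def ArithTheory (g : GoedelCoding L) (T : L.Theory) : Prop := IsArithmetical (theoryCode g T)

/-! ## Coded structures -/

/-- A coded `L`-structure: an `L`-structure whose domain is a subset of `ℕ`
with infinite complement. -/
structure CodedStructure (L : FirstOrder.Language) where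
  carrier : Set ℕ
  compl_infinite : (carrierᶜ : Set ℕ).Infinite
  struc : L.Structure ↥carrier

/-- A coded structure is a model of `T`. -/
def CodedStructure.Models (M : CodedStructure L) (T : L.Theory) : Prop :=
  ∀ φ ∈ T, @Sentence.Realize L ↥M.carrier M.struc φ

/-- The (coded) elementary diagram of a coded structure. -/
def elemDiagram (g : GoedelCoding L) (M : CodedStructure L) : Set ℕ :=
  { c | ∃ (k : ℕ) (φ : L.Formula (Fin k)) (a : Fin k → ↥M.carrier),
      c = Nat.pair (Nat.pair k (formulaCode g Fin.val φ)) (tupleCode fun i => ((a i : ℕ))) ∧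
      (letI := M.struc; φ.Realize a) }

/-- A coded structure is arithmetically decidable if its elementary diagram is arithmetical. -/
def ArithDecidable (g : GoedelCoding L) (M : CodedStructure L) : Prop :=
  IsArithmetical (elemDiagram g M)

/-- `M ≼ N` for coded structures: `M`'s domain is contained in `N`'s, and the
inclusion is elementary. -/
structure ElemSub (M N : CodedStructure L) : Prop where
  subset : M.carrier ⊆ N.carrier
  elem : ∀ (k : ℕ) (φ : L.Formula (Fin k)) (a : Fin k → ↥M.carrier),
    (letI := M.struc; φ.Realize a) ↔
      (letI := N.struc; φ.Realize (fun i => (⟨((a i : ℕ)), subset (a i).2⟩ : ↥N.carrier)))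

/-- A coded model of `T` is arithmetically extendible if it is an elementary substructure of
an arithmetically decidable coded model of `T`. -/
def ArithExtendible (g : GoedelCoding L) (T : L.Theory) (M : CodedStructure L) : Prop :=
  ∃ N : CodedStructure L, ArithDecidable g N ∧ N.Models T ∧ ElemSub M N

/-! ## Model-theoretic notions in arbitrary structures -/

/-- `N` (with structure `SN`) is a model of `T`. -/
def ModelsT (L : FirstOrder.Language) (T : L.Theory) (N : Type) (SN : L.Structure N) : Prop :=
  ∀ φ ∈ T, @Sentence.Realize L N SN φ

/-- `T` has no finite models. -/
def NoFiniteModels (L : FirstOrder.Language) (T : L.Theory) : Prop :=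
  ∀ (N : Type) (SN : L.Structure N), ModelsT L T N SN → Infinite N

/-- Elementary embeddings, with the structures given explicitly. -/
def EEmb (L : FirstOrder.Language) (M : Type) (SM : L.Structure M)
    (N : Type) (SN : L.Structure N) : Type _ :=
  @FirstOrder.Language.ElementaryEmbedding L M N SM SN

/-- The underlying map of an elementary embedding. -/
def EEmb.fn {L : FirstOrder.Language} {M : Type} {SM : L.Structure M}
    {N : Type} {SN : L.Structure N} (j : EEmb L M SM N SN) : M → N :=
  @FirstOrder.Language.ElementaryEmbedding.toFun L M N SM SN j

/-- A subset of `N^n` definable with parameters from `P`. -/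
def DefinableOverT (L : FirstOrder.Language) (N : Type) (SN : L.Structure N) (P : Set N)
    {n : ℕ} (X : Set (Fin n → N)) : Prop :=
  letI := SN
  ∃ (m : ℕ) (ψ : L.Formula (Fin n ⊕ Fin m)) (b : Fin m → N),
    (∀ i, b i ∈ P) ∧ X = { v | ψ.Realize (Sum.elim v b) }

/-- A subset of `N` definable with (arbitrary) parameters. -/
def Definable1 (L : FirstOrder.Language) (N : Type) (SN : L.Structure N) (Y : Set N) : Prop :=
  letI := SN
  ∃ (m : ℕ) (ψ : L.Formula (Fin 1 ⊕ Fin m)) (b : Fin m → N),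
    Y = { x : N | ψ.Realize (Sum.elim (fun _ => x) b) }

/-- The algebraic closure of `B` in `N`: elements satisfying a formula with parameters
from `B` having finitely many solutions. -/
def aclIn (L : FirstOrder.Language) (N : Type) (SN : L.Structure N) (B : Set N) : Set N :=
  letI := SN
  { a : N | ∃ (k : ℕ) (φ : L.Formula (Fin 1 ⊕ Fin k)) (b : Fin k → N),
      (∀ i, b i ∈ B) ∧ φ.Realize (Sum.elim (fun _ => a) b) ∧
      { x : N | φ.Realize (Sum.elim (fun _ => x) b) }.Finite }

/-- The domain of the substructure of `N` generated by `B`: values of terms at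
arguments from `B`. -/
def genSub (L : FirstOrder.Language) (N : Type) (SN : L.Structure N) (B : Set N) : Set N :=
  letI := SN
  { a : N | ∃ (t : L.Term ℕ) (v : ℕ → N), (∀ i, v i ∈ B) ∧ a = t.realize v }

/-- The set defined by a formula `φ(x, p̄)` in one free variable with parameters `p̄`. -/
def smSet (L : FirstOrder.Language) (N : Type) (SN : L.Structure N) {k : ℕ}
    (φ : L.Formula (Fin 1 ⊕ Fin k)) (p : Fin k → N) : Set N :=
  letI := SN
  { x : N | φ.Realize (Sum.elim (fun _ => x) p) }

/-- A definable tuple-set in a coded structure, with parameters from `P`. -/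
def DefinableOver (M : CodedStructure L) (P : Set ↥M.carrier) {n : ℕ}
    (X : Set (Fin n → ↥M.carrier)) : Prop :=
  DefinableOverT L ↥M.carrier M.struc P X

/-- A definable tuple-set in a coded structure, with arbitrary parameters. -/
def DefinableIn (M : CodedStructure L) {n : ℕ} (X : Set (Fin n → ↥M.carrier)) : Prop :=
  DefinableOver M Set.univ X

/-! ## Isomorphisms of coded structures and `D`-categoricity -/

/-- An isomorphism of coded `L`-structures. -/
structure CodedIso (M N : CodedStructure L) where
  toFun : ↥M.carrier → ↥N.carrier
  invFun : ↥N.carrier → ↥M.carrier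
  left_inv : Function.LeftInverse invFun toFun
  right_inv : Function.RightInverse invFun toFun
  map_fun : ∀ {k : ℕ} (f : L.Functions k) (v : Fin k → ↥M.carrier),
    toFun (M.struc.funMap f v) = N.struc.funMap f (toFun ∘ v)
  map_rel : ∀ {k : ℕ} (r : L.Relations k) (v : Fin k → ↥M.carrier),
    M.struc.RelMap r v ↔ N.struc.RelMap r (toFun ∘ v)

/-- `f` is a `D`-preserving isomorphism, where `d` is a representative of the
arithmetic degree `D`. -/
def DPreserving (d : Set ℕ) {M N : CodedStructure L} (f : CodedIso M N) : Prop :=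
  ArReducible (graphCode f.toFun) d ∧
  ArReducible (graphCode f.invFun) d ∧
  (∀ (n : ℕ) (X : Set (Fin n → ↥M.carrier)), DefinableIn M X →
      ArEquiv (tupleSetCode X) d →
      ArEquiv (tupleSetCode ((fun v => f.toFun ∘ v) '' X)) d) ∧
  (∀ (n : ℕ) (Y : Set (Fin n → ↥N.carrier)), DefinableIn N Y →
      ArEquiv (tupleSetCode Y) d →
      ArEquiv (tupleSetCode ((fun v => f.invFun ∘ v) '' Y)) d)

/-- `T` is `D`-categorical, where `d` is a representative of the nonzero
arithmetic degree `D`. -/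
def DCategorical (g : GoedelCoding L) (T : L.Theory) (d : Set ℕ) : Prop :=
  ∀ M₀ M₁ M₂ : CodedStructure L,
    ArithDecidable g M₀ → M₀.Models T →
    M₁.Models T → ArithExtendible g T M₁ →
    M₂.Models T → ArithExtendible g T M₂ →
    ElemSub M₀ M₁ → ElemSub M₀ M₂ →
    ArEquiv M₁.carrier d → ArEquiv M₂.carrier d →
    ∃ f : CodedIso M₁ M₂, DPreserving d f ∧
      ∀ (x : ℕ) (hx : x ∈ M₀.carrier) (h₁ : x ∈ M₁.carrier),
        ((f.toFun ⟨x, h₁⟩ : ℕ)) = x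

/-! ## Vaughtian pairs, prime models, strong minimality -/

/-- `T` has a Vaughtian pair. -/
def HasVaughtianPair (T : L.Theory) : Prop :=
  ∃ (N : Type) (SN : L.Structure N),
    ModelsT L T N SN ∧
    ∃ S : @FirstOrder.Language.ElementarySubstructure L N SN,
      ((S.toSubstructure : Set N) ≠ Set.univ ∧
      ∃ (k : ℕ) (φ : L.Formula (Fin 1 ⊕ Fin k)) (a : Fin k → N),
        (∀ i, a i ∈ (S.toSubstructure : Set N)) ∧
        smSet L N SN φ a ⊆ (S.toSubstructure : Set N) ∧
        (smSet L N SN φ a).Infinite)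

/-- A coded model of `T` is prime: it elementarily embeds into every model of `T`. -/
def PrimeModel (L : FirstOrder.Language) (T : L.Theory) (P : CodedStructure L) : Prop :=
  P.Models T ∧ ∀ (N : Type) (SN : L.Structure N), ModelsT L T N SN →
    Nonempty (EEmb L ↥P.carrier P.struc N SN)

/-- `φ(x, p̄)` is strongly minimal over the coded model `M`: its solution set in `M` is
infinite, and in every elementary extension of `M` modelling `T` every definable subset of
its solution set is finite or cofinite in it. -/
def StronglyMinimalOver (T : L.Theory) (M : CodedStructure L) {k : ℕ}
    (φ : L.Formula (Fin 1 ⊕ Fin k)) (p : Fin k → ↥M.carrier) : Prop :=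
  (smSet L ↥M.carrier M.struc φ p).Infinite ∧
  ∀ (N : Type) (SN : L.Structure N), ModelsT L T N SN →
    ∀ j : EEmb L ↥M.carrier M.struc N SN,
      ∀ Y : Set N, Definable1 L N SN Y →
        Y ⊆ smSet L N SN φ (fun i => j.fn (p i)) →
        (Y.Finite ∨ ((smSet L N SN φ (fun i => j.fn (p i))) \ Y).Finite)

/-- `T` is a strongly minimal theory: every model is infinite, and every
parameter-definable subset of any model is finite or cofinite. -/
def StronglyMinimalTheory (L : FirstOrder.Language) (T : L.Theory) : Prop :=
  (∀ (N : Type) (SN : L.Structure N), ModelsT L T N SN → Infinite N) ∧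
  (∀ (N : Type) (SN : L.Structure N), ModelsT L T N SN →
    ∀ Y : Set N, Definable1 L N SN Y → (Y.Finite ∨ (Yᶜ : Set N).Finite))

/-- The structural control clause: an arithmetically decidable prime model together with
a strongly minimal formula over it generating every elementary extension. -/
def GeneratesAll (T : L.Theory) (P : CodedStructure L) {k : ℕ}
    (φ : L.Formula (Fin 1 ⊕ Fin k)) (p : Fin k → ↥P.carrier) : Prop :=
  ∀ (N : Type) (SN : L.Structure N), ModelsT L T N SN →
    ∀ j : EEmb L ↥P.carrier P.struc N SN,
      aclIn L N SN (Set.range j.fn ∪ smSet L N SN φ (fun i => j.fn (p i))) = Set.univ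

/-- Clause (3) of the arithmetic Baldwin–Lachlan theorem. -/
def SMControl (g : GoedelCoding L) (T : L.Theory) : Prop :=
  ∃ (P : CodedStructure L), ArithDecidable g P ∧ PrimeModel L T P ∧
    ∃ (k : ℕ) (φ : L.Formula (Fin 1 ⊕ Fin k)) (p : Fin k → ↥P.carrier),
      StronglyMinimalOver T P φ p ∧ GeneratesAll T P φ p

/-! ## Types and arithmetical stability -/

/-- A formula with a finite parameter tuple from a coded structure, in `n` object
variables. -/
def ParamFormula (L : FirstOrder.Language) (M : CodedStructure L) (n : ℕ) : Type :=
  Σ k : ℕ, L.Formula (Fin n ⊕ Fin k) × (Fin k → ↥M.carrier)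

/-- All parameters of `q` lie in `A`. -/
def paramsIn {M : CodedStructure L} {n : ℕ} (A : Set ℕ) (q : ParamFormula L M n) : Prop :=
  ∀ i, ((q.2.2 i : ℕ)) ∈ A

/-- `p` is consistent with the elementary diagram of `M`: it is realized in some
elementary extension of `M`. -/
def TypeConsistent (M : CodedStructure L) {n : ℕ} (p : Set (ParamFormula L M n)) : Prop :=
  ∃ (N : Type) (SN : L.Structure N) (j : EEmb L ↥M.carrier M.struc N SN) (b : Fin n → N),
    ∀ q ∈ p, letI := SN; q.2.1.Realize (Sum.elim b (fun i => j.fn (q.2.2 i)))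

/-- `p` is a (complete) `n`-type over `A` inside `M`: a maximal set of formulas with
parameters from `A` consistent with the elementary diagram of `M`. -/
def IsNType (M : CodedStructure L) (A : Set ℕ) (n : ℕ)
    (p : Set (ParamFormula L M n)) : Prop :=
  (∀ q ∈ p, paramsIn A q) ∧
  TypeConsistent M p ∧
  ∀ q : ParamFormula L M n, paramsIn A q → q ∉ p → ¬ TypeConsistent M (insert q p)

/-- The code of a formula-with-parameters. -/
def pfCode (g : GoedelCoding L) {M : CodedStructure L} {n : ℕ} (q : ParamFormula L M n) : ℕ :=
  Nat.pair
    (Nat.pair q.1 (formulaCode g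
      (Sum.elim (fun i : Fin n => Nat.pair 0 i.1) (fun j : Fin q.1 => Nat.pair 1 j.1)) q.2.1))
    (tupleCode fun i => ((q.2.2 i : ℕ)))

/-- The set of codes of the formulas of `p`. -/
def typeCode (g : GoedelCoding L) {M : CodedStructure L} {n : ℕ}
    (p : Set (ParamFormula L M n)) : Set ℕ :=
  { c | ∃ q ∈ p, c = pfCode g q }

/-- `p` is realized in the coded elementary extension `N` of `M`. -/
def RealizesType {M N : CodedStructure L} (h : M.carrier ⊆ N.carrier) {n : ℕ}
    (p : Set (ParamFormula L M n)) : Prop :=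
  ∃ b : Fin n → ↥N.carrier, ∀ q ∈ p,
    letI := N.struc
    q.2.1.Realize (Sum.elim b (fun i => (⟨((q.2.2 i : ℕ)), h (q.2.2 i).2⟩ : ↥N.carrier)))

/-- The `(n, i)`-th column of an effective join. -/
def tripleSection (X : Set ℕ) (n i : ℕ) : Set ℕ := { m | Nat.pair n (Nat.pair i m) ∈ X }

/-- `T` is arithmetically stable: over every arithmetically decidable model and every
arithmetical parameter set, the family of arithmetic `n`-types (for all `n ≥ 1`) has a
uniform arithmetical code in which every arithmetic `n`-type appears at least once. -/
def ArithStable (g : GoedelCoding L) (T : L.Theory) : Prop :=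
  ∀ M : CodedStructure L, ArithDecidable g M → M.Models T →
    ∀ A : Set ℕ, A ⊆ M.carrier → IsArithmetical A →
      ∃ X : Set ℕ, IsArithmetical X ∧
        (∀ n, 1 ≤ n → ∀ i : ℕ, ∃ p : Set (ParamFormula L M n),
            IsNType M A n p ∧ IsArithmetical (typeCode g p) ∧
            tripleSection X n i = typeCode g p) ∧
        (∀ n, 1 ≤ n → ∀ p : Set (ParamFormula L M n),
            IsNType M A n p → IsArithmetical (typeCode g p) →
            ∃ i : ℕ, tripleSection X n i = typeCode g p)

/-- The set of elements occurring as a coordinate of a tuple in `X`. -/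
def coordSet {N : Type} {n : ℕ} (X : Set (Fin n → N)) : Set N :=
  { m | ∃ v ∈ X, ∃ i, v i = m }

section Definability

/-! ## Closure properties of the relations definable in arithmetic with an oracle -/

/-- The relation `P` is definable in `(ℕ, +, ·, 0, 1, <, Y)`. -/
def ArDef (Y : Set ℕ) {α : Type} (P : (α → ℕ) → Prop) : Prop :=
  letI := arithStructure Y
  ∃ φ : arithLang.Formula α, ∀ v, φ.Realize v ↔ P v

/-- The function `f` has a graph definable in `(ℕ, +, ·, 0, 1, <, Y)`. -/
def ArFun (Y : Set ℕ) {α : Type} (f : (α → ℕ) → ℕ) : Prop :=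
  ArDef Y fun v : Option α → ℕ => v none = f fun a => v (some a)

variable {Y : Set ℕ} {α β : Type}

theorem ArDef.of_iff {P Q : (α → ℕ) → Prop} (h : ArDef Y P) (hPQ : ∀ v, P v ↔ Q v) :
    ArDef Y Q := by
  obtain rfl : P = Q := funext fun v => propext (hPQ v)
  exact h

theorem ArDef.not {P : (α → ℕ) → Prop} (h : ArDef Y P) : ArDef Y fun v => ¬ P v := by
  let := arithStructure Y
  obtain ⟨φ, hφ⟩ := h
  exact ⟨φ.not, fun v => by rw [Formula.realize_not, hφ]⟩

theorem ArDef.and {P Q : (α → ℕ) → Prop} (hP : ArDef Y P) (hQ : ArDef Y Q) :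
    ArDef Y fun v => P v ∧ Q v := by
  let := arithStructure Y
  obtain ⟨φ, hφ⟩ := hP
  obtain ⟨ψ, hψ⟩ := hQ
  exact ⟨φ ⊓ ψ, fun v => by rw [Formula.realize_inf, hφ, hψ]⟩

theorem ArDef.or {P Q : (α → ℕ) → Prop} (hP : ArDef Y P) (hQ : ArDef Y Q) :
    ArDef Y fun v => P v ∨ Q v :=
  (hP.not.and hQ.not).not.of_iff fun v => by tauto

theorem ArDef.imp {P Q : (α → ℕ) → Prop} (hP : ArDef Y P) (hQ : ArDef Y Q) :
    ArDef Y fun v => P v → Q v :=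
  (hP.not.or hQ).of_iff fun v => by tauto

theorem ArDef.iAnd [Finite β] {P : β → (α → ℕ) → Prop} (h : ∀ i, ArDef Y (P i)) :
    ArDef Y fun v => ∀ i, P i v := by
  let := arithStructure Y
  choose φ hφ using h
  exact ⟨Formula.iInf φ, fun v => by simp [Formula.realize_iInf, hφ]⟩

theorem ArDef.relabel {P : (α → ℕ) → Prop} (h : ArDef Y P) (g : α → β) :
    ArDef Y fun v => P fun a => v (g a) := by
  let := arithStructure Y
  obtain ⟨φ, hφ⟩ := h
  exact ⟨φ.relabel g, fun v => by rw [Formula.realize_relabel, hφ]; rfl⟩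

theorem ArDef.exists_tuple [Finite β] {P : (α ⊕ β → ℕ) → Prop} (h : ArDef Y P) :
    ArDef Y fun v => ∃ w : β → ℕ, P (Sum.elim v w) := by
  let := arithStructure Y
  obtain ⟨φ, hφ⟩ := h
  exact ⟨φ.iExs β, fun v => by simp only [Formula.realize_iExs, hφ]⟩

theorem ArDef.comp [Finite β] {P : (β → ℕ) → Prop} (hP : ArDef Y P)
    {f : β → (α → ℕ) → ℕ} (hf : ∀ i, ArFun Y (f i)) : ArDef Y fun v => P fun i => f i v := by
  have h : ∀ i, ArDef Y fun v : α ⊕ β → ℕ => v (Sum.inr i) = f i fun a => v (Sum.inl a) :=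
    fun i => ArDef.relabel (hf i) fun o => o.elim (Sum.inr i) Sum.inl
  refine ((ArDef.iAnd h).and (hP.relabel Sum.inr)).exists_tuple.of_iff fun v => ?_
  simp only [Sum.elim_inr, Sum.elim_inl]
  constructor
  · rintro ⟨w, hw, hPw⟩
    rwa [← funext hw]
  · exact fun hv => ⟨_, fun _ => rfl, hv⟩

theorem ArFun.relabel {f : (α → ℕ) → ℕ} (h : ArFun Y f) (g : α → β) :
    ArFun Y fun v => f fun a => v (g a) :=
  (ArDef.relabel h (Option.map g)).of_iff fun _ => Iff.rfl

theorem ArDef.equal_terms (t s : arithLang.Term α) :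
    ArDef Y fun v => letI := arithStructure Y; t.realize v = s.realize v := by
  let := arithStructure Y
  exact ⟨t.equal s, fun v => Formula.realize_equal⟩

theorem ArFun.of_term (t : arithLang.Term α) :
    ArFun Y fun v => letI := arithStructure Y; t.realize v := by
  let := arithStructure Y
  refine (ArDef.equal_terms (Term.var none) (t.relabel some)).of_iff fun v => ?_
  simp only [Term.realize_relabel, Term.realize_var]
  rfl

theorem ArFun.proj (a : α) : ArFun Y fun v => v a := ArFun.of_term (Term.var a)

theorem ArFun.comp [Finite β] {f : (β → ℕ) → ℕ} (hf : ArFun Y f)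
    {g : β → (α → ℕ) → ℕ} (hg : ∀ i, ArFun Y (g i)) : ArFun Y fun v => f fun i => g i v := by
  let G : Option β → (Option α → ℕ) → ℕ :=
    fun o v => o.elim (v none) fun i => g i fun a => v (some a)
  have hG : ∀ o, ArFun Y (G o)
    | none => ArFun.proj none
    | some i => (hg i).relabel some
  exact (ArDef.comp hf hG).of_iff fun _ => Iff.rfl

theorem ArFun.zero : ArFun Y fun _ : α → ℕ => 0 :=
  ArFun.of_term (Constants.term (L := arithLang) ArFunc.zero)

theorem ArFun.one : ArFun Y fun _ : α → ℕ => 1 :=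
  ArFun.of_term (Constants.term (L := arithLang) ArFunc.one)

theorem ArFun.comp₂ {F : ℕ → ℕ → ℕ} (hF : ArFun Y fun v : Fin 2 → ℕ => F (v 0) (v 1))
    {f g : (α → ℕ) → ℕ} (hf : ArFun Y f) (hg : ArFun Y g) : ArFun Y fun v => F (f v) (g v) :=
  ArFun.comp hF (g := ![f, g]) fun i => by fin_cases i <;> assumption

theorem ArFun.add {f g : (α → ℕ) → ℕ} (hf : ArFun Y f) (hg : ArFun Y g) :
    ArFun Y fun v => f v + g v :=
  ArFun.comp₂ (ArFun.of_term
    (Functions.apply₂ (L := arithLang) ArFunc.add (Term.var 0) (Term.var 1))) hf hg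

theorem ArFun.mul {f g : (α → ℕ) → ℕ} (hf : ArFun Y f) (hg : ArFun Y g) :
    ArFun Y fun v => f v * g v :=
  ArFun.comp₂ (ArFun.of_term
    (Functions.apply₂ (L := arithLang) ArFunc.mul (Term.var 0) (Term.var 1))) hf hg

theorem ArDef.comp₂ {P : ℕ → ℕ → Prop} (hP : ArDef Y fun v : Fin 2 → ℕ => P (v 0) (v 1))
    {f g : (α → ℕ) → ℕ} (hf : ArFun Y f) (hg : ArFun Y g) : ArDef Y fun v => P (f v) (g v) :=
  ArDef.comp hP (f := ![f, g]) fun i => by fin_cases i <;> assumption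

theorem ArDef.eq {f g : (α → ℕ) → ℕ} (hf : ArFun Y f) (hg : ArFun Y g) :
    ArDef Y fun v => f v = g v :=
  ArDef.comp₂ (ArDef.equal_terms (Term.var 0) (Term.var 1)) hf hg

theorem ArDef.lt {f g : (α → ℕ) → ℕ} (hf : ArFun Y f) (hg : ArFun Y g) :
    ArDef Y fun v => f v < g v := by
  let := arithStructure Y
  refine ArDef.comp₂ ⟨Relations.formula₂ (L := arithLang) ArRel.lt (Term.var 0) (Term.var 1),
    fun v => ?_⟩ hf hg
  exact Formula.realize_rel₂ (L := arithLang) (R := ArRel.lt)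

theorem ArDef.mem_oracle {f : (α → ℕ) → ℕ} (hf : ArFun Y f) : ArDef Y fun v => f v ∈ Y := by
  let := arithStructure Y
  have h : ArDef Y fun v : Fin 1 → ℕ => v 0 ∈ Y :=
    ⟨Relations.formula₁ (L := arithLang) ArRel.mem (Term.var 0), fun v =>
      Formula.realize_rel₁ (L := arithLang) (R := ArRel.mem)⟩
  exact ArDef.comp h (f := fun _ => f) fun _ => hf

theorem ArDef.exists {P : ℕ → (α → ℕ) → Prop}
    (h : ArDef Y fun v : Option α → ℕ => P (v none) fun a => v (some a)) :
    ArDef Y fun v => ∃ x, P x v := by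
  refine (h.relabel fun o => o.elim (Sum.inr ()) Sum.inl).exists_tuple.of_iff fun v => ?_
  exact ⟨fun ⟨w, hw⟩ => ⟨w (), hw⟩, fun ⟨x, hx⟩ => ⟨fun _ => x, hx⟩⟩

theorem ArDef.forall {P : ℕ → (α → ℕ) → Prop}
    (h : ArDef Y fun v : Option α → ℕ => P (v none) fun a => v (some a)) :
    ArDef Y fun v => ∀ x, P x v :=
  (ArDef.exists (P := fun x v => ¬ P x v) h.not).not.of_iff fun v => by simp

theorem ArFun.natPair {f g : (α → ℕ) → ℕ} (hf : ArFun Y f) (hg : ArFun Y g) :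
    ArFun Y fun v => Nat.pair (f v) (g v) := by
  refine ArFun.comp₂ ?_ hf hg
  have hx : ArFun Y fun v : Option (Fin 2) → ℕ => v (some 0) := ArFun.proj _
  have hy : ArFun Y fun v : Option (Fin 2) → ℕ => v (some 1) := ArFun.proj _
  have hz : ArFun Y fun v : Option (Fin 2) → ℕ => v none := ArFun.proj _
  refine (((ArDef.lt hx hy).and (ArDef.eq hz ((hy.mul hy).add hx))).or
    ((ArDef.lt hx hy).not.and (ArDef.eq hz (((hx.mul hx).add hx).add hy)))).of_iff fun v => ?_
  dsimp only
  unfold Nat.pair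
  split_ifs with h <;> simp [h]

theorem ArFun.comp₁ {F : ℕ → ℕ} (hF : ArFun Y fun v : Unit → ℕ => F (v ()))
    {f : (α → ℕ) → ℕ} (hf : ArFun Y f) : ArFun Y fun v => F (f v) :=
  ArFun.comp hF (g := fun _ => f) fun _ => hf

theorem ArFun.unpair_fst {f : (α → ℕ) → ℕ} (hf : ArFun Y f) :
    ArFun Y fun v => (f v).unpair.1 := by
  refine ArFun.comp₁ (F := fun x => x.unpair.1) ?_ hf
  refine (ArDef.exists (P := fun w v => v (some ()) = Nat.pair (v none) w)
    (ArDef.eq (ArFun.proj _) (ArFun.natPair (ArFun.proj _) (ArFun.proj _)))).of_iff fun v => ?_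
  constructor
  · rintro ⟨w, hw⟩
    simp [hw]
  · exact fun h => ⟨(v (some ())).unpair.2, by rw [h, Nat.pair_unpair]⟩

theorem ArFun.unpair_snd {f : (α → ℕ) → ℕ} (hf : ArFun Y f) :
    ArFun Y fun v => (f v).unpair.2 := by
  refine ArFun.comp₁ (F := fun x => x.unpair.2) ?_ hf
  refine (ArDef.exists (P := fun w v => v (some ()) = Nat.pair w (v none))
    (ArDef.eq (ArFun.proj _) (ArFun.natPair (ArFun.proj _) (ArFun.proj _)))).of_iff fun v => ?_
  constructor
  · rintro ⟨w, hw⟩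
    simp [hw]
  · exact fun h => ⟨(v (some ())).unpair.1, by rw [h, Nat.pair_unpair]⟩

theorem ArFun.mod_succ {f g : (α → ℕ) → ℕ} (hf : ArFun Y f) (hg : ArFun Y g) :
    ArFun Y fun v => f v % (g v + 1) := by
  refine ArFun.comp₂ (F := fun x y => x % (y + 1)) ?_ hf hg
  refine ((ArDef.lt (ArFun.proj none) ((ArFun.proj (some 1)).add ArFun.one)).and
    (ArDef.exists (P := fun q v => v (some 0) = (v (some 1) + 1) * q + v none)
    (ArDef.eq (ArFun.proj _) ((((ArFun.proj _).add ArFun.one).mul (ArFun.proj _)).add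
      (ArFun.proj _))))).of_iff fun v => ?_
  constructor
  · rintro ⟨h, q, hq⟩
    dsimp only
    rw [hq, Nat.mul_add_mod, Nat.mod_eq_of_lt h]
  · intro h
    dsimp only at h
    rw [h]
    exact ⟨Nat.mod_lt _ (Nat.succ_pos _), _, (Nat.div_add_mod _ _).symm⟩

theorem ArFun.beta {f g : (α → ℕ) → ℕ} (hf : ArFun Y f) (hg : ArFun Y g) :
    ArFun Y fun v => Nat.beta (f v) (g v) :=
  hf.unpair_fst.mod_succ ((hg.add ArFun.one).mul hf.unpair_snd)

theorem exists_beta_eq (s : ℕ → ℕ) (n : ℕ) : ∃ c, ∀ i ≤ n, Nat.beta c i = s i := by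
  refine ⟨Nat.unbeta (List.ofFn fun i : Fin (n + 1) => s i), fun i hi => ?_⟩
  have h := Nat.beta_unbeta_coe (List.ofFn fun i : Fin (n + 1) => s i) ⟨i, by simp; omega⟩
  rw [h, Fin.getElem_fin, List.getElem_ofFn]

theorem ArFun.nat_rec {a b : ℕ → ℕ} (ha : ArFun Y fun v : Unit → ℕ => a (v ()))
    (hb : ArFun Y fun v : Unit → ℕ => b (v ())) :
    ArFun Y fun v : Fin 2 → ℕ =>
      Nat.rec (motive := fun _ => ℕ) (a (v 0)) (fun y ih => b (Nat.pair (v 0) (Nat.pair y ih)))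
        (v 1) := by
  refine (ArDef.exists (P := fun s v => Nat.beta s 0 = a (v (some 0)) ∧
    (∀ y, y < v (some 1) → Nat.beta s (y + 1) =
      b (Nat.pair (v (some 0)) (Nat.pair y (Nat.beta s y)))) ∧ v none = Nat.beta s (v (some 1)))
    ?_).of_iff fun v => ?_
  · refine (ArDef.eq ((ArFun.proj _).beta ArFun.zero) (ha.comp₁ (ArFun.proj _))).and
      ((ArDef.forall (P := fun y v => y < v (some (some 1)) → Nat.beta (v none) (y + 1) =
        b (Nat.pair (v (some (some 0))) (Nat.pair y (Nat.beta (v none) y)))) ?_).and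
        (ArDef.eq (ArFun.proj _) ((ArFun.proj _).beta (ArFun.proj _))))
    exact (ArDef.lt (ArFun.proj _) (ArFun.proj _)).imp
      (ArDef.eq ((ArFun.proj _).beta ((ArFun.proj _).add ArFun.one))
        (hb.comp₁ ((ArFun.proj _).natPair
          ((ArFun.proj _).natPair ((ArFun.proj _).beta (ArFun.proj _))))))
  · constructor
    · rintro ⟨s, h0, hs, hn⟩
      have key : ∀ y ≤ v (some 1), Nat.beta s y = Nat.rec (motive := fun _ => ℕ) (a (v (some 0)))
          (fun y ih => b (Nat.pair (v (some 0)) (Nat.pair y ih))) y := by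
        intro y hy
        induction y with
        | zero => exact h0
        | succ y ih => rw [hs y hy, ih (by omega)]
      rw [hn, key _ le_rfl]
    · intro h
      obtain ⟨s, hs⟩ := exists_beta_eq (fun y => Nat.rec (motive := fun _ => ℕ) (a (v (some 0)))
          (fun y ih => b (Nat.pair (v (some 0)) (Nat.pair y ih))) y) (v (some 1))
      refine ⟨s, hs 0 (Nat.zero_le _), fun y hy => ?_, ?_⟩
      · rw [hs (y + 1) hy, hs y hy.le]
      · rw [h, hs _ le_rfl]

theorem ArFun.of_primrec {F : ℕ → ℕ} (hF : Nat.Primrec F) :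
    ArFun Y fun v : Unit → ℕ => F (v ()) := by
  induction hF with
  | zero => exact ArFun.zero
  | succ => exact (ArFun.proj _).add ArFun.one
  | left => exact (ArFun.proj _).unpair_fst
  | right => exact (ArFun.proj _).unpair_snd
  | pair _ _ ih₁ ih₂ => exact ih₁.natPair ih₂
  | comp _ _ ih₁ ih₂ => exact ih₁.comp₁ ih₂
  | @prec a b _ _ ih₁ ih₂ =>
    exact ArFun.comp₂ (F := fun z n => Nat.rec (a z) (fun y ih => b (Nat.pair z (Nat.pair y ih))) n)
      (ArFun.nat_rec ih₁ ih₂) (ArFun.proj ()).unpair_fst (ArFun.proj ()).unpair_snd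

/-! ## Arithmetical predicates on encodable types -/

/-- The set of codes of elements satisfying `p` is arithmetical in the oracle `Y`. -/
def ArPred (Y : Set ℕ) {A : Type} [Primcodable A] (p : A → Prop) : Prop :=
  ArDef Y fun v : Unit → ℕ => ∃ a ∈ Encodable.decode (α := A) (v ()), p a

variable {A B C : Type} [Primcodable A] [Primcodable B] [Primcodable C]

theorem ArPred.of_iff {p q : A → Prop} (h : ArPred Y p) (hpq : ∀ a, p a ↔ q a) : ArPred Y q := by
  obtain rfl : p = q := funext fun a => propext (hpq a)
  exact h

theorem arReducible_iff_arDef {X : Set ℕ} :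
    ArReducible X Y ↔ ArDef Y fun v : Unit → ℕ => v () ∈ X := by
  let := arithStructure Y
  constructor
  · rintro ⟨φ, hφ⟩
    have h : ArDef Y fun v : Fin 1 → ℕ => v 0 ∈ X := by
      refine ⟨φ, fun v => ?_⟩
      have hv : v = fun _ => v 0 := funext fun i => by rw [Subsingleton.elim i 0]
      rw [hφ, hv]
      rfl
    exact (h.relabel fun _ => ()).of_iff fun v => Iff.rfl
  · intro h
    obtain ⟨φ, hφ⟩ := h.relabel fun _ => (0 : Fin 1)
    exact ⟨φ, Set.ext fun n => (hφ fun _ => n).symm⟩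

theorem arReducible_iff_arPred {X : Set ℕ} : ArReducible X Y ↔ ArPred Y (· ∈ X) := by
  rw [arReducible_iff_arDef, ArPred]
  simp

theorem ArPred.comp {p : B → Prop} (hp : ArPred Y p) {f : A → B} (hf : Primrec f) :
    ArPred Y fun a => p (f a) := by
  have hF := ArFun.of_primrec (Y := Y) hf
  refine (ArDef.exists (P := fun k v => Encodable.encode
      ((Encodable.decode (α := A) (v ())).map f) = k + 1 ∧
      ∃ b ∈ Encodable.decode (α := B) k, p b)
    ((ArDef.eq (hF.relabel fun _ => some ()) ((ArFun.proj _).add ArFun.one)).and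
      (ArDef.relabel hp fun _ => none))).of_iff fun v => ?_
  cases h : Encodable.decode (α := A) (v ()) <;> simp

theorem ArPred.and {p q : A → Prop} (hp : ArPred Y p) (hq : ArPred Y q) :
    ArPred Y fun a => p a ∧ q a := by
  refine (ArDef.and hp hq).of_iff fun v => ?_
  cases h : Encodable.decode (α := A) (v ()) <;> simp

theorem ArPred.not {p : A → Prop} (hp : ArPred Y p) : ArPred Y fun a => ¬ p a := by
  refine ((ArDef.eq (ArFun.of_primrec (Primcodable.prim (α := A))) ArFun.zero).not.and
    (ArDef.not hp)).of_iff fun v => ?_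
  cases h : Encodable.decode (α := A) (v ()) <;> simp

theorem ArPred.or {p q : A → Prop} (hp : ArPred Y p) (hq : ArPred Y q) :
    ArPred Y fun a => p a ∨ q a :=
  (hp.not.and hq.not).not.of_iff fun v => by tauto

theorem ArPred.imp {p q : A → Prop} (hp : ArPred Y p) (hq : ArPred Y q) :
    ArPred Y fun a => p a → q a :=
  (hp.not.or hq).of_iff fun v => by tauto

theorem ArPred.iff {p q : A → Prop} (hp : ArPred Y p) (hq : ArPred Y q) :
    ArPred Y fun a => p a ↔ q a :=
  ((hp.imp hq).and (hq.imp hp)).of_iff fun v => by tauto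

theorem ArPred.exists {p : A → B → Prop} (hp : ArPred Y fun x : A × B => p x.1 x.2) :
    ArPred Y fun a => ∃ b, p a b := by
  refine (ArDef.exists (P := fun k v => ∃ x ∈ Encodable.decode (α := A × B)
    (Nat.pair (v ()) k), p x.1 x.2)
    (ArDef.comp (f := fun _ v => Nat.pair (v (some ())) (v none)) hp fun _ =>
      (ArFun.proj _).natPair (ArFun.proj _))).of_iff fun v => ?_
  cases h : Encodable.decode (α := A) (v ()) with
  | none => simp [h]
  | some a =>
    simp only [Encodable.decode_prod_val, Nat.unpair_pair, h]
    constructor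
    · rintro ⟨k, x, hx, hpx⟩
      cases hk : Encodable.decode (α := B) k with
      | none => simp [hk] at hx
      | some b =>
        simp only [hk, Option.bind_some, Option.map_some, Option.mem_def,
          Option.some.injEq] at hx
        subst hx
        exact ⟨a, rfl, b, hpx⟩
    · rintro ⟨a', ha, b, hb⟩
      obtain rfl : a = a' := by simpa using ha
      exact ⟨Encodable.encode b, (a, b), by simp, hb⟩

theorem ArPred.forall {p : A → B → Prop} (hp : ArPred Y fun x : A × B => p x.1 x.2) :
    ArPred Y fun a => ∀ b, p a b :=
  (ArPred.exists (p := fun a b => ¬ p a b) hp.not).not.of_iff fun v => by simp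

theorem ArPred.of_primrecPred {p : A → Prop} (hp : PrimrecPred p) : ArPred Y p := by
  obtain ⟨_, hp⟩ := hp
  have h : ArPred Y fun b : Bool => b = true := by
    refine (ArDef.eq (ArFun.proj ()) ArFun.one).of_iff fun v => ?_
    constructor
    · intro h
      rw [h]
      exact ⟨true, rfl, rfl⟩
    · rintro ⟨_, h, rfl⟩
      revert h
      generalize v () = n
      match n with
      | 0 => intro h; cases h
      | 1 => intro _; rfl
      | n + 2 =>
        intro h
        exact absurd h (by
          rw [Encodable.decode_ge_two _ (by omega)]
          simp)
  exact (h.comp hp).of_iff fun a => by simp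

theorem ArPred.eq {f g : A → B} (hf : Primrec f) (hg : Primrec g) :
    ArPred Y fun a => f a = g a :=
  ArPred.of_primrecPred (Primrec.eq.comp hf hg)

theorem ArPred.lt {f g : A → ℕ} (hf : Primrec f) (hg : Primrec g) :
    ArPred Y fun a => f a < g a :=
  ArPred.of_primrecPred (Primrec.nat_lt.comp hf hg)

theorem ArPred.mem_oracle {f : A → ℕ} (hf : Primrec f) : ArPred Y fun a => f a ∈ Y := by
  refine ArPred.comp (p := (· ∈ Y)) ?_ hf
  rw [← arReducible_iff_arPred, arReducible_iff_arDef]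
  exact ArDef.mem_oracle (ArFun.proj _)

theorem ArPred.mem_list {f : A → B} {l : A → List B} (hf : Primrec f) (hl : Primrec l) :
    ArPred Y fun a => f a ∈ l a := by
  refine (ArPred.exists (B := List B) (p := fun a s => ∃ t, l a = s ++ f a :: t)
    (ArPred.exists (ArPred.eq (hl.comp (Primrec.fst.comp Primrec.fst))
      (Primrec.list_append.comp (Primrec.snd.comp Primrec.fst) (Primrec.list_cons.comp
        (hf.comp (Primrec.fst.comp Primrec.fst)) Primrec.snd))))).of_iff fun a => ?_
  exact List.mem_iff_append.symm

end Definability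

section Transfer

/-- Two families indexed by the same type have the same order type. -/
def SameOrder {ι M N : Type} [LE M] [LE N] (f : ι → M) (f' : ι → N) : Prop :=
  ∀ i j, f i ≤ f j ↔ f' i ≤ f' j

variable {ι M N : Type} [LinearOrder M] [LinearOrder N]

theorem SameOrder.symm {f : ι → M} {f' : ι → N} (h : SameOrder f f') : SameOrder f' f :=
  fun i j => (h i j).symm

theorem SameOrder.eq_iff {f : ι → M} {f' : ι → N} (h : SameOrder f f') (i j : ι) :
    f i = f j ↔ f' i = f' j := by
  rw [le_antisymm_iff, le_antisymm_iff, h, h]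

theorem SameOrder.lt_iff {f : ι → M} {f' : ι → N} (h : SameOrder f f') (i j : ι) :
    f i < f j ↔ f' i < f' j := by
  rw [← not_le, ← not_le, h]

/-- A one-point extension of a finite configuration can be copied in a dense linear order
without endpoints. -/
theorem SameOrder.exists_extension [Finite ι] [DenselyOrdered N] [NoMinOrder N] [NoMaxOrder N]
    [Nonempty N] {f : ι → M} {f' : ι → N} (h : SameOrder f f') (x : M) :
    ∃ y : N, ∀ i, (f i ≤ x ↔ f' i ≤ y) ∧ (x ≤ f i ↔ y ≤ f' i) := by
  classical
  have := Fintype.ofFinite ι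
  by_cases hx : ∃ j, f j = x
  · obtain ⟨j, rfl⟩ := hx
    exact ⟨f' j, fun i => ⟨h i j, h j i⟩⟩
  · push Not at hx
    obtain ⟨y, hlo, hhi⟩ := Order.exists_between_finsets
      ((Finset.univ.filter fun i => f i < x).image f')
      ((Finset.univ.filter fun i => x < f i).image f') (by
        simp only [Finset.mem_image, Finset.mem_filter, Finset.mem_univ, true_and]
        rintro _ ⟨i, hi, rfl⟩ _ ⟨j, hj, rfl⟩
        exact (h.lt_iff i j).1 (hi.trans hj))
    simp only [Finset.mem_image, Finset.mem_filter, Finset.mem_univ, true_and,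
      forall_exists_index, and_imp, forall_apply_eq_imp_iff₂] at hlo hhi
    refine ⟨y, fun i => ?_⟩
    rcases lt_or_gt_of_ne (hx i) with hi | hi
    · simp [hi.le, hi.not_ge, (hlo i hi).le, (hlo i hi).not_ge]
    · simp [hi.le, hi.not_ge, (hhi i hi).le, (hhi i hi).not_ge]

theorem exists_eq_var {α : Type} (t : Language.order.Term α) : ∃ a, t = Term.var a := by
  cases t with
  | var a => exact ⟨a, rfl⟩
  | func f _ => exact f.elim

theorem sameOrder_elim_snoc {α : Type} {n : ℕ} {v : α → M} {w : Fin n → M} {v' : α → N}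
    {w' : Fin n → N} (h : SameOrder (Sum.elim v w) (Sum.elim v' w')) {x : M} {y : N}
    (hxy : ∀ i, (Sum.elim v w i ≤ x ↔ Sum.elim v' w' i ≤ y) ∧
      (x ≤ Sum.elim v w i ↔ y ≤ Sum.elim v' w' i)) :
    SameOrder (Sum.elim v (Fin.snoc w x)) (Sum.elim v' (Fin.snoc w' y)) := by
  have key : ∀ i : α ⊕ Fin (n + 1),
      (∃ j, Sum.elim v (Fin.snoc w x) i = Sum.elim v w j ∧
        Sum.elim v' (Fin.snoc w' y) i = Sum.elim v' w' j) ∨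
      (Sum.elim v (Fin.snoc w x) i = x ∧ Sum.elim v' (Fin.snoc w' y) i = y) := by
    rintro (a | i)
    · exact Or.inl ⟨Sum.inl a, rfl, rfl⟩
    · induction i using Fin.lastCases with
      | last => right; simp
      | cast i => left; exact ⟨Sum.inr i, by simp, by simp⟩
  intro i j
  rcases key i with ⟨i', hi, hi'⟩ | ⟨hi, hi'⟩ <;> rcases key j with ⟨j', hj, hj'⟩ | ⟨hj, hj'⟩ <;>
    rw [hi, hi', hj, hj']
  · exact h i' j'
  · exact (hxy i').1
  · exact (hxy j').2
  · simp

variable [Language.order.Structure M] [Language.order.OrderedStructure M]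
  [Language.order.Structure N] [Language.order.OrderedStructure N]
  [DenselyOrdered M] [NoMinOrder M] [NoMaxOrder M] [Nonempty M]
  [DenselyOrdered N] [NoMinOrder N] [NoMaxOrder N] [Nonempty N]

/-- The truth of an order formula in a dense linear order without endpoints only depends on the
order type of the assignment. -/
theorem SameOrder.realize_iff {α : Type} [Finite α] {n : ℕ} (φ : Language.order.BoundedFormula α n)
    {v : α → M} {w : Fin n → M} {v' : α → N} {w' : Fin n → N}
    (h : SameOrder (Sum.elim v w) (Sum.elim v' w')) : φ.Realize v w ↔ φ.Realize v' w' := by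
  induction φ with
  | falsum => rfl
  | equal t₁ t₂ =>
    obtain ⟨a, rfl⟩ := exists_eq_var t₁
    obtain ⟨b, rfl⟩ := exists_eq_var t₂
    exact h.eq_iff a b
  | @rel n l R ts =>
    cases R
    change Structure.RelMap leSymb _ ↔ Structure.RelMap leSymb _
    rw [relMap_leSymb, relMap_leSymb]
    obtain ⟨a, ha⟩ := exists_eq_var (ts 0)
    obtain ⟨b, hb⟩ := exists_eq_var (ts 1)
    rw [ha, hb]
    exact h a b
  | imp φ₁ φ₂ ih₁ ih₂ =>
    rw [BoundedFormula.realize_imp, BoundedFormula.realize_imp, ih₁ h, ih₂ h]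
  | all φ ih =>
    rw [BoundedFormula.realize_all, BoundedFormula.realize_all]
    constructor
    · intro hφ y
      obtain ⟨x, hx⟩ := h.symm.exists_extension y
      exact (ih (sameOrder_elim_snoc h fun i => ⟨(hx i).1.symm, (hx i).2.symm⟩)).1 (hφ x)
    · intro hφ x
      obtain ⟨y, hy⟩ := h.exists_extension x
      exact (ih (sameOrder_elim_snoc h hy)).2 (hφ y)

end Transfer

section RationalTruth

instance : Language.order.Structure ℚ := orderStructure ℚ

instance : Language.order.OrderedStructure ℚ := ⟨fun _ => Iff.rfl⟩

/-- The assignment of rational values given by a list of naturals. -/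
def ratVal (U : List ℕ) {k : ℕ} (i : Fin k) : ℚ := (U.getD i 0 : ℕ)

/-- Makes room between consecutive values. -/
def spread (U : List ℕ) : List ℕ := U.map fun y => 2 * y + 1

theorem length_spread (U : List ℕ) : (spread U).length = U.length := List.length_map _

theorem getD_spread {U : List ℕ} {i : ℕ} (hi : i < U.length) :
    (spread U).getD i 0 = 2 * U.getD i 0 + 1 := by
  simp [spread, hi]

theorem ratVal_append_singleton {W : List ℕ} {n : ℕ} (hW : W.length = n) (c : ℕ) :
    (ratVal (W ++ [c]) : Fin (n + 1) → ℚ) = Fin.snoc (ratVal W) (c : ℚ) := by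
  subst hW
  funext i
  induction i using Fin.lastCases with
  | last => simp [ratVal]
  | cast i => simp [ratVal]

theorem sameOrder_spread {U W : List ℕ} {k n : ℕ} (hU : U.length = k) (hW : W.length = n) :
    SameOrder (Sum.elim (ratVal U : Fin k → ℚ) (ratVal W : Fin n → ℚ))
      (Sum.elim (ratVal (spread U) : Fin k → ℚ) (ratVal (spread W) : Fin n → ℚ)) := by
  have hU' (i : Fin k) : (ratVal (spread U) i : ℚ) = 2 * ratVal U i + 1 := by
    rw [ratVal, getD_spread (hU ▸ i.2)]
    push_cast
    rfl
  have hW' (i : Fin n) : (ratVal (spread W) i : ℚ) = 2 * ratVal W i + 1 := by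
    rw [ratVal, getD_spread (hW ▸ i.2)]
    push_cast
    rfl
  rintro (i | i) (j | j) <;> simp [hU', hW']

theorem exists_spread_position (B : ℕ) (x : ℚ) : ∃ c ≤ 2 * B, ∀ y < B,
    ((y : ℚ) ≤ x ↔ ((2 * y + 1 : ℕ) : ℚ) ≤ c) ∧ (x ≤ y ↔ (c : ℚ) ≤ (2 * y + 1 : ℕ)) := by
  simp only [Nat.cast_le]
  rcases lt_or_ge x 0 with hx | hx
  · refine ⟨0, by omega, fun y _ => ?_⟩
    have : (0 : ℚ) ≤ y := by positivity
    exact ⟨⟨fun h => by linarith, fun h => by omega⟩, ⟨fun _ => by omega, fun _ => by linarith⟩⟩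
  rcases le_or_gt (B : ℚ) x with hB | hB
  · refine ⟨2 * B, le_rfl, fun y hy => ?_⟩
    have : (y : ℚ) < B := by exact_mod_cast hy
    exact ⟨⟨fun h => by omega, fun h => by linarith⟩, ⟨fun _ => by linarith, fun _ => by omega⟩⟩
  have hm : ⌊x⌋₊ < B := (Nat.floor_lt hx).2 hB
  have h₁ (y : ℕ) : (y : ℚ) ≤ x ↔ y ≤ ⌊x⌋₊ := (Nat.le_floor_iff hx).symm
  have hle : (⌊x⌋₊ : ℚ) ≤ x := Nat.floor_le hx
  by_cases he : x = ⌊x⌋₊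
  · refine ⟨2 * ⌊x⌋₊ + 1, by omega, fun y _ => ⟨by rw [h₁]; omega, ?_⟩⟩
    conv_lhs => rw [he]
    rw [Nat.cast_le]
    omega
  · refine ⟨2 * ⌊x⌋₊ + 2, by omega, fun y _ => ⟨by rw [h₁]; omega, ?_⟩⟩
    have hne (h : x = y) : False := he (by rw [h, Nat.floor_natCast])
    constructor
    · intro h
      have h₂ : x < y := lt_of_le_of_ne h hne
      have : ⌊x⌋₊ < y := (Nat.floor_lt hx).2 h₂
      omega
    · intro h
      exact ((Nat.floor_lt hx).1 (by omega)).le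

theorem realize_all_iff {U W : List ℕ} {k n B : ℕ}
    (φ : Language.order.BoundedFormula (Fin k) (n + 1)) (hU : U.length = k) (hW : W.length = n)
    (hUB : ∀ y ∈ U, y < B) (hWB : ∀ y ∈ W, y < B) :
    φ.all.Realize (ratVal U) (ratVal W) ↔
      ∀ c ≤ 2 * B, φ.Realize (ratVal (spread U)) (ratVal (spread W ++ [c])) := by
  rw [BoundedFormula.realize_all]
  have h := sameOrder_spread hU hW
  have hW' : (spread W).length = n := (length_spread W).trans hW
  simp only [ratVal_append_singleton hW']
  constructor
  · intro hφ c _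
    obtain ⟨x, hx⟩ := h.symm.exists_extension (c : ℚ)
    exact ((sameOrder_elim_snoc h.symm hx).realize_iff φ).2 (hφ x)
  · intro hφ x
    obtain ⟨c, hc, hx⟩ := exists_spread_position B x
    refine ((sameOrder_elim_snoc h ?_).realize_iff φ).2 (hφ c hc)
    rintro (i | i)
    · have hi : (i : ℕ) < U.length := hU ▸ i.2
      simp only [Sum.elim_inl, ratVal, getD_spread hi]
      exact hx _ (hUB _ (by simp [hi]))
    · have hi : (i : ℕ) < W.length := hW ▸ i.2
      simp only [Sum.elim_inr, ratVal, getD_spread hi]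
      exact hx _ (hWB _ (by simp [hi]))

end RationalTruth

section Tokens

variable (g : GoedelCoding Language.order) {k n : ℕ}

/-- The list of numbers whose list code is the code of a formula. -/
def formulaTokens (φ : Language.order.BoundedFormula (Fin k) n) : List ℕ :=
  φ.listEncode.map (Sum.elim
    (fun p => Nat.pair 0 (Nat.pair p.1
      (termCode g (Sum.elim (fun a => Nat.pair 0 (Fin.val a)) (fun i => Nat.pair 1 i.1)) p.2)))
    (Sum.elim
      (fun q => Nat.pair 1 (Nat.pair q.1 (g.encRel q.1 q.2)))
      (fun m => Nat.pair 2 m)))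

theorem formulaCode_eq (φ : Language.order.BoundedFormula (Fin k) n) :
    formulaCode g Fin.val φ = listCode (formulaTokens g φ) := rfl

theorem termCode_injective {L : FirstOrder.Language} (g : GoedelCoding L) {α : Type} {e : α → ℕ}
    (he : Function.Injective e) : Function.Injective (termCode g e) := by
  refine Encodable.encode_injective.comp
    ((List.map_injective_iff.2 ?_).comp Term.listEncode_injective)
  rintro (a | ⟨m, f⟩) (b | ⟨m', f'⟩) h <;> simp only [Sum.elim_inl, Sum.elim_inr,
    Nat.pair_eq_pair, true_and, zero_ne_one, one_ne_zero, false_and] at h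
  · rw [he h]
  · obtain ⟨rfl, h⟩ := h
    rw [g.encFun_inj _ h]

theorem formulaTokens_injective :
    Function.Injective (formulaTokens g (k := k) (n := n)) := by
  have he (m : ℕ) : Function.Injective
      (Sum.elim (fun a : Fin k => Nat.pair 0 a.1) (fun i : Fin m => Nat.pair 1 i.1)) := by
    rintro (a | a) (b | b) h <;> simp_all [Nat.pair_eq_pair, Fin.ext_iff]
  intro φ ψ h
  have hl : φ.listEncode = ψ.listEncode := by
    refine List.map_injective_iff.2 ?_ h
    rintro (⟨m, t⟩ | ⟨m, R⟩ | m) (⟨m', t'⟩ | ⟨m', R'⟩ | m') h <;> simp only [Sum.elim_inl,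
      Sum.elim_inr, Nat.pair_eq_pair, true_and, zero_ne_one, one_ne_zero, false_and,
      OfNat.zero_ne_ofNat, OfNat.ofNat_ne_zero, OfNat.one_ne_ofNat, OfNat.ofNat_ne_one] at h
    · obtain ⟨rfl, h⟩ := h
      rw [termCode_injective g (he m) h]
    · obtain ⟨rfl, h⟩ := h
      rw [g.encRel_inj _ h]
    · rw [h]
  have hs := BoundedFormula.listEncode_sigma_injective (a₁ := ⟨n, φ⟩) (a₂ := ⟨n, ψ⟩) hl
  exact eq_of_heq (Sigma.mk.inj hs).2

/-- The code of a variable. -/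
def varCode : Fin k ⊕ Fin n → ℕ :=
  Sum.elim (fun a => Nat.pair 0 a.1) (fun i => Nat.pair 1 i.1)

/-- The token of a variable with code `τ`, in a formula with `n` bound variables. -/
def atomToken (n τ : ℕ) : ℕ := Nat.pair 0 (Nat.pair n (listCode [Nat.pair 0 τ]))

theorem formulaTokens_falsum :
    formulaTokens g (BoundedFormula.falsum : Language.order.BoundedFormula (Fin k) n) =
      [Nat.pair 2 (n + 2)] := rfl

theorem formulaTokens_equal (a b : Fin k ⊕ Fin n) :
    formulaTokens g (BoundedFormula.equal (Term.var a) (Term.var b)) =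
      [atomToken n (varCode a), atomToken n (varCode b)] := rfl

theorem formulaTokens_rel (a b : Fin k ⊕ Fin n) :
    formulaTokens g ((leSymb : Language.order.Relations 2).boundedFormula₂
      (Term.var a) (Term.var b)) =
      [Nat.pair 1 (Nat.pair 2 (g.encRel 2 leSymb)), Nat.pair 2 n,
        atomToken n (varCode a), atomToken n (varCode b)] := rfl

theorem formulaTokens_imp (φ ψ : Language.order.BoundedFormula (Fin k) n) :
    formulaTokens g (φ.imp ψ) =
      Nat.pair 2 0 :: (formulaTokens g φ ++ formulaTokens g ψ) := by
  simp [formulaTokens, BoundedFormula.listEncode]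

theorem formulaTokens_all (φ : Language.order.BoundedFormula (Fin k) (n + 1)) :
    formulaTokens g φ.all = Nat.pair 2 1 :: formulaTokens g φ := rfl

end Tokens

section Evaluation

/-- An evaluation judgment: a list of tokens, values of the free variables, values of the bound
variables, and a truth value. -/
abbrev Judgment : Type := List ℕ × List ℕ × List ℕ × Bool

/-- `x` is the value of the variable with code `τ`. -/
def VarVal (U W : List ℕ) (τ x : ℕ) : Prop :=
  ∃ i, (τ = Nat.pair 0 i ∧ U[i]? = some x) ∨ (τ = Nat.pair 1 i ∧ W[i]? = some x)

theorem varVal_iff {U W : List ℕ} {τ x : ℕ} : VarVal U W τ x ↔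
    ∃ a : Fin U.length ⊕ Fin W.length, τ = varCode a ∧ Sum.elim U.get W.get a = x := by
  constructor
  · rintro ⟨i, ⟨rfl, h⟩ | ⟨rfl, h⟩⟩ <;> obtain ⟨hi, h⟩ := List.getElem?_eq_some_iff.1 h
    · exact ⟨Sum.inl ⟨i, hi⟩, rfl, h⟩
    · exact ⟨Sum.inr ⟨i, hi⟩, rfl, h⟩
  · rintro ⟨i | i, rfl, rfl⟩
    · exact ⟨i, Or.inl ⟨rfl, by simp⟩⟩
    · exact ⟨i, Or.inr ⟨rfl, by simp⟩⟩

theorem elim_ratVal (U W : List ℕ) (a : Fin U.length ⊕ Fin W.length) :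
    Sum.elim (ratVal U) (ratVal W) a = ((Sum.elim U.get W.get a : ℕ) : ℚ) := by
  rcases a with i | i <;> simp [ratVal]

/-- An atomic judgment is correct. Here `r` is the token of `≤`. -/
def AtomStep (r : ℕ) (l U W : List ℕ) (b : Bool) : Prop :=
  ∃ τ₁ τ₂ x₁ x₂, VarVal U W τ₁ x₁ ∧ VarVal U W τ₂ x₂ ∧
    ((l = [atomToken W.length τ₁, atomToken W.length τ₂] ∧ (b = true ↔ x₁ = x₂)) ∨
      (l = [r, Nat.pair 2 W.length, atomToken W.length τ₁, atomToken W.length τ₂] ∧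
        (b = true ↔ ¬ x₂ < x₁)))

/-- A judgment about an implication follows from the judgments in `t`. -/
def ImpStep (l U W : List ℕ) (b : Bool) (t : List Judgment) : Prop :=
  ∃ l₁ l₂ b₁ b₂, l = Nat.pair 2 0 :: (l₁ ++ l₂) ∧ (l₁, U, W, b₁) ∈ t ∧ (l₂, U, W, b₂) ∈ t ∧
    (b = true ↔ (b₁ = true → b₂ = true))

/-- A positive judgment about a quantified formula follows from the judgments in `t`. -/
def AllStep (l U W : List ℕ) (b : Bool) (t : List Judgment) : Prop :=
  ∃ l₁ B, l = Nat.pair 2 1 :: l₁ ∧ b = true ∧ (∀ y, y ∈ U → y < B) ∧ (∀ y, y ∈ W → y < B) ∧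
    ∀ c, c < 2 * B + 1 → (l₁, spread U, spread W ++ [c], true) ∈ t

/-- A negative judgment about a quantified formula follows from the judgments in `t`. -/
def NotAllStep (l U W : List ℕ) (b : Bool) (t : List Judgment) : Prop :=
  ∃ l₁ c, l = Nat.pair 2 1 :: l₁ ∧ b = false ∧ (l₁, spread U, spread W ++ [c], false) ∈ t

/-- The judgment `J` follows in one step from the judgments in `t`. -/
def EvalStep (r : ℕ) (J : Judgment) (t : List Judgment) : Prop :=
  (J.1 = [Nat.pair 2 (J.2.2.1.length + 2)] ∧ J.2.2.2 = false) ∨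
  AtomStep r J.1 J.2.1 J.2.2.1 J.2.2.2 ∨ ImpStep J.1 J.2.1 J.2.2.1 J.2.2.2 t ∨
  AllStep J.1 J.2.1 J.2.2.1 J.2.2.2 t ∨ NotAllStep J.1 J.2.1 J.2.2.1 J.2.2.2 t

theorem EvalStep.mono {r : ℕ} {J : Judgment} {t t' : List Judgment} (ht : t ⊆ t')
    (h : EvalStep r J t) : EvalStep r J t' := by
  rcases h with h | h | ⟨l₁, l₂, b₁, b₂, h, h₁, h₂, h₃⟩ | ⟨l₁, B, h, hb, hU, hW, h₁⟩ |
    ⟨l₁, c, h, hb, h₁⟩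
  · exact Or.inl h
  · exact Or.inr (Or.inl h)
  · exact Or.inr (Or.inr (Or.inl ⟨l₁, l₂, b₁, b₂, h, ht h₁, ht h₂, h₃⟩))
  · exact Or.inr (Or.inr (Or.inr (Or.inl
      ⟨l₁, B, h, hb, hU, hW, fun c hc => ht (h₁ c hc)⟩)))
  · exact Or.inr (Or.inr (Or.inr (Or.inr ⟨l₁, c, h, hb, ht h₁⟩)))

/-- A list of judgments each of which follows from the later ones. -/
def ValidEval (r : ℕ) : List Judgment → Prop
  | [] => True
  | x :: t => EvalStep r x t ∧ ValidEval r t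

theorem validEval_iff {r : ℕ} {w : List Judgment} :
    ValidEval r w ↔ ∀ s x t, w = s ++ x :: t → EvalStep r x t := by
  induction w with
  | nil => simp [ValidEval]
  | cons x t ih =>
    rw [ValidEval, ih]
    constructor
    · rintro ⟨h, ht⟩ s y t' he
      cases s with
      | nil =>
        obtain ⟨rfl, rfl⟩ := List.cons_eq_cons.1 he
        exact h
      | cons z s => exact ht s y t' (List.cons_eq_cons.1 he).2
    · intro h
      exact ⟨h [] x t rfl, fun s y t' he => h (x :: s) y t' (by rw [he]; rfl)⟩

theorem ValidEval.append {r : ℕ} {w w' : List Judgment} (h : ValidEval r w)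
    (h' : ValidEval r w') : ValidEval r (w ++ w') := by
  induction w with
  | nil => exact h'
  | cons x t ih => exact ⟨h.1.mono (List.subset_append_left t w'), ih h.2⟩

/-- The judgment `J` has a valid derivation. -/
def Derivable (r : ℕ) (J : Judgment) : Prop := ∃ w, ValidEval r w ∧ J ∈ w

theorem Derivable.of_step {r : ℕ} {J : Judgment} (t : List Judgment) (h : EvalStep r J t)
    (ht : ∀ x ∈ t, Derivable r x) : Derivable r J := by
  have key : ∃ w, ValidEval r w ∧ t ⊆ w := by
    clear h
    induction t with
    | nil => exact ⟨[], trivial, List.nil_subset _⟩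
    | cons x t ih =>
      obtain ⟨w, hw, hx⟩ := ht x List.mem_cons_self
      obtain ⟨w', hw', ht'⟩ := ih fun y hy => ht y (List.mem_cons_of_mem x hy)
      exact ⟨w ++ w', hw.append hw', List.cons_subset.2 ⟨List.mem_append_left _ hx,
        fun y hy => List.mem_append_right _ (ht' hy)⟩⟩
  obtain ⟨w, hw, htw⟩ := key
  exact ⟨J :: w, ⟨h.mono htw, hw⟩, List.mem_cons_self⟩

variable (g : GoedelCoding Language.order)

/-- The token of the relation symbol. -/
def leToken : ℕ := Nat.pair 1 (Nat.pair 2 (g.encRel 2 leSymb))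

/-- The judgment `J` is correct. -/
def Holds (J : Judgment) : Prop :=
  ∃ φ : Language.order.BoundedFormula (Fin J.2.1.length) J.2.2.1.length,
    formulaTokens g φ = J.1 ∧ (J.2.2.2 = true ↔ φ.Realize (ratVal J.2.1) (ratVal J.2.2.1))

theorem holds_iff {l U W : List ℕ} {b : Bool} {k n : ℕ} (hU : U.length = k) (hW : W.length = n) :
    Holds g (l, U, W, b) ↔ ∃ φ : Language.order.BoundedFormula (Fin k) n,
      formulaTokens g φ = l ∧ (b = true ↔ φ.Realize (ratVal U) (ratVal W)) := by
  subst hU hW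
  rfl

theorem exists_bound (U : List ℕ) : ∃ B, ∀ y ∈ U, y < B :=
  ⟨U.sum + 1, fun _ hy => Nat.lt_succ_of_le (List.le_sum_of_mem hy)⟩

theorem Holds.of_step {J : Judgment} {t : List Judgment} (h : EvalStep (leToken g) J t)
    (ht : ∀ x ∈ t, Holds g x) : Holds g J := by
  obtain ⟨l, U, W, b⟩ := J
  rcases h with ⟨h, hb⟩ | ⟨τ₁, τ₂, x₁, x₂, h₁, h₂, h⟩ | ⟨l₁, l₂, b₁, b₂, h, h₁, h₂, h₃⟩ |
    ⟨l₁, B, h, hb, hU, hW, h₁⟩ | ⟨l₁, c, h, hb, h₁⟩ <;> dsimp only at *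
  · subst h hb
    exact ⟨BoundedFormula.falsum, formulaTokens_falsum g, by simp [BoundedFormula.Realize]⟩
  · obtain ⟨a₁, rfl, rfl⟩ := varVal_iff.1 h₁
    obtain ⟨a₂, rfl, rfl⟩ := varVal_iff.1 h₂
    rcases h with ⟨rfl, hb⟩ | ⟨rfl, hb⟩
    · refine ⟨_, formulaTokens_equal g a₁ a₂, ?_⟩
      rw [hb, BoundedFormula.Realize, Term.realize_var, Term.realize_var, elim_ratVal, elim_ratVal,
        Nat.cast_inj]
    · refine ⟨_, formulaTokens_rel g a₁ a₂, ?_⟩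
      rw [hb, BoundedFormula.realize_rel₂, relMap_leSymb]
      simp only [Matrix.cons_val_zero, Matrix.cons_val_one, Term.realize_var, elim_ratVal,
        Nat.cast_le, not_lt]
  · obtain ⟨φ₁, rfl, hφ₁⟩ := (holds_iff g rfl rfl).1 (ht _ h₁)
    obtain ⟨φ₂, rfl, hφ₂⟩ := (holds_iff g rfl rfl).1 (ht _ h₂)
    refine ⟨φ₁.imp φ₂, (formulaTokens_imp g φ₁ φ₂).trans h.symm, ?_⟩
    rw [h₃, hφ₁, hφ₂, BoundedFormula.realize_imp]
  · have hlen (c : ℕ) : (spread W ++ [c]).length = W.length + 1 := by simp [length_spread]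
    obtain ⟨φ, rfl, -⟩ := (holds_iff g (length_spread U) (hlen 0)).1 (ht _ (h₁ 0 (by omega)))
    refine ⟨φ.all, (formulaTokens_all g φ).trans h.symm, iff_of_true hb
      ((realize_all_iff φ rfl rfl hU hW).2 fun c hc => ?_)⟩
    obtain ⟨φ', hφ', hr⟩ := (holds_iff g (length_spread U) (hlen c)).1
      (ht _ (h₁ c (Nat.lt_succ_of_le hc)))
    rw [← formulaTokens_injective g hφ']
    exact hr.1 rfl
  · obtain ⟨φ, rfl, hr⟩ := (holds_iff (n := W.length + 1) g (length_spread U)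
      (by simp [length_spread])).1 (ht _ h₁)
    obtain ⟨B₁, hB₁⟩ := exists_bound U
    obtain ⟨B₂, hB₂⟩ := exists_bound W
    refine ⟨φ.all, (formulaTokens_all g φ).trans h.symm, iff_of_false (by simp [hb]) fun hall => ?_⟩
    have := (realize_all_iff (B := B₁ + B₂ + c) φ rfl rfl
      (fun y hy => by have := hB₁ y hy; omega) (fun y hy => by have := hB₂ y hy; omega)).1 hall c
      (by omega)
    simpa using hr.2 this

theorem Derivable.holds {J : Judgment} (h : Derivable (leToken g) J) : Holds g J := by
  obtain ⟨w, hw, hJ⟩ := h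
  suffices ∀ x ∈ w, Holds g x from this J hJ
  clear hJ
  induction w with
  | nil => simp
  | cons x t ih => exact List.forall_mem_cons.2 ⟨Holds.of_step g hw.1 (ih hw.2), ih hw.2⟩

theorem derivable_of_realize_iff {k n : ℕ} (φ : Language.order.BoundedFormula (Fin k) n)
    {U W : List ℕ} (hU : U.length = k) (hW : W.length = n) {b : Bool}
    (hb : b = true ↔ φ.Realize (ratVal U) (ratVal W)) :
    Derivable (leToken g) (formulaTokens g φ, U, W, b) := by
  induction φ generalizing U W b with
  | @falsum n =>
    subst hW
    refine Derivable.of_step [] (Or.inl ⟨formulaTokens_falsum g, ?_⟩) (by simp)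
    simpa [BoundedFormula.Realize] using hb
  | @equal n t₁ t₂ =>
    subst hU hW
    obtain ⟨a₁, rfl⟩ := exists_eq_var t₁
    obtain ⟨a₂, rfl⟩ := exists_eq_var t₂
    refine Derivable.of_step [] (Or.inr (Or.inl ⟨_, _, _, _, varVal_iff.2 ⟨a₁, rfl, rfl⟩,
      varVal_iff.2 ⟨a₂, rfl, rfl⟩, Or.inl ⟨formulaTokens_equal g a₁ a₂, ?_⟩⟩)) (by simp)
    rw [hb, BoundedFormula.Realize, Term.realize_var, Term.realize_var, elim_ratVal, elim_ratVal,
      Nat.cast_inj]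
  | @rel n m R ts =>
    subst hU hW
    cases R
    obtain ⟨a₁, h₁⟩ := exists_eq_var (ts 0)
    obtain ⟨a₂, h₂⟩ := exists_eq_var (ts 1)
    obtain rfl : ts = ![Term.var a₁, Term.var a₂] := by
      funext i
      fin_cases i
      exacts [h₁, h₂]
    refine Derivable.of_step [] (Or.inr (Or.inl ⟨_, _, _, _, varVal_iff.2 ⟨a₁, rfl, rfl⟩,
      varVal_iff.2 ⟨a₂, rfl, rfl⟩, Or.inr ⟨formulaTokens_rel g a₁ a₂, ?_⟩⟩)) (by simp)
    refine hb.trans (BoundedFormula.realize_rel₂ (R := leSymb).trans ?_)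
    rw [relMap_leSymb]
    simp only [Matrix.cons_val_zero, Matrix.cons_val_one, Term.realize_var, elim_ratVal,
      Nat.cast_le, not_lt]
  | imp φ₁ φ₂ ih₁ ih₂ =>
    classical
    refine Derivable.of_step
      [(formulaTokens g φ₁, U, W, decide (φ₁.Realize (ratVal U) (ratVal W))),
        (formulaTokens g φ₂, U, W, decide (φ₂.Realize (ratVal U) (ratVal W)))]
      (Or.inr (Or.inr (Or.inl ⟨_, _, _, _, formulaTokens_imp g φ₁ φ₂, List.mem_cons_self,
        List.mem_cons_of_mem _ List.mem_cons_self, ?_⟩))) ?_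
    · rw [decide_eq_true_iff, decide_eq_true_iff, hb, BoundedFormula.realize_imp]
    · rintro x hx
      rcases List.mem_pair.1 hx with rfl | rfl
      · exact ih₁ hU hW decide_eq_true_iff
      · exact ih₂ hU hW decide_eq_true_iff
  | @all n φ ih =>
    have hU' : (spread U).length = k := (length_spread U).trans hU
    have hW' (c : ℕ) : (spread W ++ [c]).length = n + 1 := by simp [length_spread, hW]
    obtain ⟨B₁, hB₁⟩ := exists_bound U
    obtain ⟨B₂, hB₂⟩ := exists_bound W
    have hU₁ : ∀ y ∈ U, y < B₁ + B₂ := fun y hy => by have := hB₁ y hy; omega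
    have hW₁ : ∀ y ∈ W, y < B₁ + B₂ := fun y hy => by have := hB₂ y hy; omega
    rw [realize_all_iff φ hU hW hU₁ hW₁] at hb
    cases b with
    | true =>
      refine Derivable.of_step ((List.range (2 * (B₁ + B₂) + 1)).map fun c =>
        (formulaTokens g φ, spread U, spread W ++ [c], true))
        (Or.inr (Or.inr (Or.inr (Or.inl ⟨_, B₁ + B₂, formulaTokens_all g φ, rfl, hU₁, hW₁,
          fun c hc => List.mem_map.2 ⟨c, List.mem_range.2 hc, rfl⟩⟩)))) ?_
      simp only [List.mem_map, List.mem_range, forall_exists_index, and_imp]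
      rintro _ c hc rfl
      exact ih hU' (hW' c) (iff_of_true rfl (hb.1 rfl c (by omega)))
    | false =>
      simp only [Bool.false_eq_true, false_iff, not_forall] at hb
      obtain ⟨c, hc, hφ⟩ := hb
      refine Derivable.of_step [(formulaTokens g φ, spread U, spread W ++ [c], false)]
        (Or.inr (Or.inr (Or.inr (Or.inr ⟨_, c, formulaTokens_all g φ, rfl,
          List.mem_cons_self⟩)))) ?_
      rintro x hx
      rw [List.mem_singleton.1 hx]
      exact ih hU' (hW' c) (iff_of_false (by simp) hφ)

end Evaluation

section ArithmeticalTruth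

variable {Y : Set ℕ} {A : Type} [Primcodable A]

theorem primrec_spread {f : A → List ℕ} (hf : Primrec f) : Primrec fun a => spread (f a) :=
  Primrec.list_map hf (Primrec.nat_add.comp
    (Primrec.nat_mul.comp (Primrec.const 2) Primrec.snd) (Primrec.const 1))

theorem primrec_singleton {B : Type} [Primcodable B] {f : A → B} (hf : Primrec f) :
    Primrec fun a => [f a] :=
  Primrec.list_cons.comp hf (Primrec.const [])

theorem primrec_atomToken {f h : A → ℕ} (hf : Primrec f) (hh : Primrec h) :
    Primrec fun a => atomToken (f a) (h a) :=
  Primrec₂.natPair.comp (Primrec.const 0) (Primrec₂.natPair.comp hf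
    (Primrec.encode.comp (primrec_singleton (Primrec₂.natPair.comp (Primrec.const 0) hh))))

theorem ArPred.varVal {U W : A → List ℕ} {τ x : A → ℕ} (hU : Primrec U) (hW : Primrec W)
    (hτ : Primrec τ) (hx : Primrec x) : ArPred Y fun a => VarVal (U a) (W a) (τ a) (x a) := by
  have hτ' : Primrec fun p : A × ℕ => τ p.1 := hτ.comp Primrec.fst
  have hx' : Primrec fun p : A × ℕ => some (x p.1) :=
    Primrec.option_some.comp (hx.comp Primrec.fst)
  exact ArPred.exists (.or
    (.and (.eq hτ' (Primrec₂.natPair.comp (Primrec.const 0) Primrec.snd))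
      (.eq (Primrec.list_getElem?.comp (hU.comp Primrec.fst) Primrec.snd) hx'))
    (.and (.eq hτ' (Primrec₂.natPair.comp (Primrec.const 1) Primrec.snd))
      (.eq (Primrec.list_getElem?.comp (hW.comp Primrec.fst) Primrec.snd) hx')))

theorem ArPred.eq_true {b : A → Bool} (hb : Primrec b) : ArPred Y fun a => b a = true :=
  ArPred.eq hb (Primrec.const true)

variable {l U W : A → List ℕ} {b : A → Bool} {t : A → List Judgment}

theorem ArPred.atomStep (r : ℕ) (hl : Primrec l) (hU : Primrec U) (hW : Primrec W)
    (hb : Primrec b) : ArPred Y fun a => AtomStep r (l a) (U a) (W a) (b a) := by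
  have fst : Primrec fun p : A × ℕ × ℕ × ℕ × ℕ => p.1 := Primrec.fst
  have h₁ : Primrec fun p : A × ℕ × ℕ × ℕ × ℕ => p.2.1 := Primrec.fst.comp Primrec.snd
  have h₂ : Primrec fun p : A × ℕ × ℕ × ℕ × ℕ => p.2.2.1 :=
    Primrec.fst.comp (Primrec.snd.comp Primrec.snd)
  have h₃ : Primrec fun p : A × ℕ × ℕ × ℕ × ℕ => p.2.2.2.1 :=
    Primrec.fst.comp (Primrec.snd.comp (Primrec.snd.comp Primrec.snd))
  have h₄ : Primrec fun p : A × ℕ × ℕ × ℕ × ℕ => p.2.2.2.2 :=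
    Primrec.snd.comp (Primrec.snd.comp (Primrec.snd.comp Primrec.snd))
  have hn : Primrec fun p : A × ℕ × ℕ × ℕ × ℕ => (W p.1).length :=
    Primrec.list_length.comp (hW.comp fst)
  have hat := Primrec.list_cons.comp (primrec_atomToken hn h₁)
    (primrec_singleton (primrec_atomToken hn h₂))
  have hbt : ArPred Y fun p : A × ℕ × ℕ × ℕ × ℕ => b p.1 = true := ArPred.eq_true (hb.comp fst)
  refine (ArPred.exists (B := ℕ × ℕ × ℕ × ℕ) (p := fun a y => VarVal (U a) (W a) y.1 y.2.2.1 ∧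
    VarVal (U a) (W a) y.2.1 y.2.2.2 ∧
    ((l a = [atomToken (W a).length y.1, atomToken (W a).length y.2.1] ∧
        (b a = true ↔ y.2.2.1 = y.2.2.2)) ∨
      (l a = [r, Nat.pair 2 (W a).length, atomToken (W a).length y.1,
          atomToken (W a).length y.2.1] ∧ (b a = true ↔ ¬ y.2.2.2 < y.2.2.1)))) ?_).of_iff
    fun a => by simp only [Prod.exists, AtomStep]
  exact .and (.varVal (hU.comp fst) (hW.comp fst) h₁ h₃)
    (.and (.varVal (hU.comp fst) (hW.comp fst) h₂ h₄)
      (.or (.and (.eq (hl.comp fst) hat) (.iff hbt (.eq h₃ h₄)))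
        (.and (.eq (hl.comp fst) (Primrec.list_cons.comp (Primrec.const r)
          (Primrec.list_cons.comp (Primrec₂.natPair.comp (Primrec.const 2) hn) hat)))
          (.iff hbt (.not (.lt h₄ h₃))))))

theorem ArPred.impStep (hl : Primrec l) (hU : Primrec U) (hW : Primrec W) (hb : Primrec b)
    (ht : Primrec t) : ArPred Y fun a => ImpStep (l a) (U a) (W a) (b a) (t a) := by
  have fst : Primrec fun p : A × List ℕ × List ℕ × Bool × Bool => p.1 := Primrec.fst
  have h₁ : Primrec fun p : A × List ℕ × List ℕ × Bool × Bool => p.2.1 :=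
    Primrec.fst.comp Primrec.snd
  have h₂ : Primrec fun p : A × List ℕ × List ℕ × Bool × Bool => p.2.2.1 :=
    Primrec.fst.comp (Primrec.snd.comp Primrec.snd)
  have h₃ : Primrec fun p : A × List ℕ × List ℕ × Bool × Bool => p.2.2.2.1 :=
    Primrec.fst.comp (Primrec.snd.comp (Primrec.snd.comp Primrec.snd))
  have h₄ : Primrec fun p : A × List ℕ × List ℕ × Bool × Bool => p.2.2.2.2 :=
    Primrec.snd.comp (Primrec.snd.comp (Primrec.snd.comp Primrec.snd))
  refine (ArPred.exists (B := List ℕ × List ℕ × Bool × Bool) (p := fun a y =>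
    l a = Nat.pair 2 0 :: (y.1 ++ y.2.1) ∧ (y.1, U a, W a, y.2.2.1) ∈ t a ∧
      (y.2.1, U a, W a, y.2.2.2) ∈ t a ∧ (b a = true ↔ (y.2.2.1 = true → y.2.2.2 = true)))
    ?_).of_iff fun a => by simp only [Prod.exists, ImpStep]
  exact .and (.eq (hl.comp fst)
      (Primrec.list_cons.comp (Primrec.const (Nat.pair 2 0)) (Primrec.list_append.comp h₁ h₂)))
    (.and (.mem_list (h₁.pair ((hU.comp fst).pair ((hW.comp fst).pair h₃))) (ht.comp fst))
      (.and (.mem_list (h₂.pair ((hU.comp fst).pair ((hW.comp fst).pair h₄))) (ht.comp fst))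
        (.iff (.eq_true (hb.comp fst)) (.imp (.eq_true h₃) (.eq_true h₄)))))

theorem ArPred.forall_mem_lt (hU : Primrec U) {B : A → ℕ} (hB : Primrec B) :
    ArPred Y fun a => ∀ y, y ∈ U a → y < B a :=
  ArPred.forall (.imp (.mem_list Primrec.snd (hU.comp Primrec.fst))
    (.lt Primrec.snd (hB.comp Primrec.fst)))

theorem ArPred.allStep (hl : Primrec l) (hU : Primrec U) (hW : Primrec W) (hb : Primrec b)
    (ht : Primrec t) : ArPred Y fun a => AllStep (l a) (U a) (W a) (b a) (t a) := by
  have fst : Primrec fun p : A × List ℕ × ℕ => p.1 := Primrec.fst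
  have h₁ : Primrec fun p : A × List ℕ × ℕ => p.2.1 := Primrec.fst.comp Primrec.snd
  have h₂ : Primrec fun p : A × List ℕ × ℕ => p.2.2 := Primrec.snd.comp Primrec.snd
  have fst' : Primrec fun p : (A × List ℕ × ℕ) × ℕ => p.1.1 := fst.comp Primrec.fst
  refine (ArPred.exists (B := List ℕ × ℕ) (p := fun a y =>
    l a = Nat.pair 2 1 :: y.1 ∧ b a = true ∧ (∀ z, z ∈ U a → z < y.2) ∧
      (∀ z, z ∈ W a → z < y.2) ∧ ∀ c, c < 2 * y.2 + 1 →
        (y.1, spread (U a), spread (W a) ++ [c], true) ∈ t a)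
    ?_).of_iff fun a => by simp only [Prod.exists, AllStep]
  exact .and (.eq (hl.comp fst) (Primrec.list_cons.comp (Primrec.const (Nat.pair 2 1)) h₁))
    (.and (.eq_true (hb.comp fst)) (.and (.forall_mem_lt (hU.comp fst) h₂)
      (.and (.forall_mem_lt (hW.comp fst) h₂) (.forall (.imp
        (.lt Primrec.snd (Primrec.succ.comp (Primrec.nat_mul.comp (Primrec.const 2)
          (h₂.comp Primrec.fst))))
        (.mem_list ((h₁.comp Primrec.fst).pair ((primrec_spread (hU.comp fst')).pair
          ((Primrec.list_append.comp (primrec_spread (hW.comp fst'))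
            (primrec_singleton Primrec.snd)).pair (Primrec.const true)))) (ht.comp fst')))))))

theorem ArPred.notAllStep (hl : Primrec l) (hU : Primrec U) (hW : Primrec W) (hb : Primrec b)
    (ht : Primrec t) : ArPred Y fun a => NotAllStep (l a) (U a) (W a) (b a) (t a) := by
  have fst : Primrec fun p : A × List ℕ × ℕ => p.1 := Primrec.fst
  have h₁ : Primrec fun p : A × List ℕ × ℕ => p.2.1 := Primrec.fst.comp Primrec.snd
  have h₂ : Primrec fun p : A × List ℕ × ℕ => p.2.2 := Primrec.snd.comp Primrec.snd
  refine (ArPred.exists (B := List ℕ × ℕ) (p := fun a y =>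
    l a = Nat.pair 2 1 :: y.1 ∧ b a = false ∧
      (y.1, spread (U a), spread (W a) ++ [y.2], false) ∈ t a)
    ?_).of_iff fun a => by simp only [Prod.exists, NotAllStep]
  exact .and (.eq (hl.comp fst) (Primrec.list_cons.comp (Primrec.const (Nat.pair 2 1)) h₁))
    (.and (.eq (hb.comp fst) (Primrec.const false))
      (.mem_list (h₁.pair ((primrec_spread (hU.comp fst)).pair
        ((Primrec.list_append.comp (primrec_spread (hW.comp fst)) (primrec_singleton h₂)).pair
          (Primrec.const false)))) (ht.comp fst)))

theorem ArPred.evalStep (r : ℕ) {J : A → Judgment} (hJ : Primrec J) (ht : Primrec t) :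
    ArPred Y fun a => EvalStep r (J a) (t a) := by
  have hl : Primrec fun a => (J a).1 := Primrec.fst.comp hJ
  have hU : Primrec fun a => (J a).2.1 := Primrec.fst.comp (Primrec.snd.comp hJ)
  have hW : Primrec fun a => (J a).2.2.1 :=
    Primrec.fst.comp (Primrec.snd.comp (Primrec.snd.comp hJ))
  have hb : Primrec fun a => (J a).2.2.2 :=
    Primrec.snd.comp (Primrec.snd.comp (Primrec.snd.comp hJ))
  exact .or (.and (.eq hl (primrec_singleton (Primrec₂.natPair.comp (Primrec.const 2)
      (Primrec.nat_add.comp (Primrec.list_length.comp hW) (Primrec.const 2)))))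
      (.eq hb (Primrec.const false)))
    (.or (.atomStep r hl hU hW hb) (.or (.impStep hl hU hW hb ht)
      (.or (.allStep hl hU hW hb ht) (.notAllStep hl hU hW hb ht))))

theorem ArPred.validEval (r : ℕ) : ArPred Y (ValidEval r) := by
  have hs : Primrec fun p : List Judgment × List Judgment × Judgment × List Judgment => p.2.1 :=
    Primrec.fst.comp Primrec.snd
  have hx : Primrec fun p : List Judgment × List Judgment × Judgment × List Judgment => p.2.2.1 :=
    Primrec.fst.comp (Primrec.snd.comp Primrec.snd)
  have ht : Primrec fun p : List Judgment × List Judgment × Judgment × List Judgment => p.2.2.2 :=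
    Primrec.snd.comp (Primrec.snd.comp Primrec.snd)
  refine (ArPred.forall (B := List Judgment × Judgment × List Judgment) (p := fun w y =>
    w = y.1 ++ y.2.1 :: y.2.2 → EvalStep r y.2.1 y.2.2) ?_).of_iff fun w => by
      simp only [Prod.forall, validEval_iff]
  exact .imp (.eq Primrec.fst (Primrec.list_append.comp hs (Primrec.list_cons.comp hx ht)))
    (.evalStep r hx ht)

theorem ArPred.derivable (r : ℕ) {J : A → Judgment} (hJ : Primrec J) :
    ArPred Y fun a => Derivable r (J a) :=
  ArPred.exists (.and ((ArPred.validEval r).comp Primrec.snd)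
    (.mem_list (hJ.comp Primrec.fst) Primrec.snd))

end ArithmeticalTruth

section DyadicPoints

/-- The dyadic rational coded by a natural number. -/
def dyadic (c : ℕ) : ℚ := (2 * c.unpair.1 + 1) / 2 ^ c.unpair.2

theorem dyadic_le_iff (x y : ℕ) : dyadic x ≤ dyadic y ↔
    (2 * x.unpair.1 + 1) * 2 ^ y.unpair.2 ≤ (2 * y.unpair.1 + 1) * 2 ^ x.unpair.2 := by
  rw [dyadic, dyadic, div_le_div_iff₀ (by positivity) (by positivity)]
  exact_mod_cast Iff.rfl

theorem dyadic_pos (c : ℕ) : 0 < dyadic c := by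
  unfold dyadic
  positivity

theorem two_mul_add_one_mul_two_pow_inj {p q m n : ℕ}
    (h : (2 * p + 1) * 2 ^ m = (2 * q + 1) * 2 ^ n) : p = q ∧ m = n := by
  induction m generalizing n with
  | zero =>
    cases n with
    | zero => omega
    | succ n =>
      rw [pow_succ, ← mul_assoc] at h
      omega
  | succ m ih =>
    cases n with
    | zero =>
      rw [pow_succ, ← mul_assoc] at h
      omega
    | succ n =>
      rw [pow_succ, pow_succ, ← mul_assoc, ← mul_assoc] at h
      obtain ⟨hp, hm⟩ := ih (Nat.eq_of_mul_eq_mul_right two_pos h)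
      exact ⟨hp, by rw [hm]⟩

theorem dyadic_injective : Function.Injective dyadic := by
  intro x y h
  have := two_mul_add_one_mul_two_pow_inj
    (le_antisymm ((dyadic_le_iff x y).1 h.le) ((dyadic_le_iff y x).1 h.ge))
  rw [← Nat.pair_unpair x, ← Nat.pair_unpair y, this.1, this.2]

theorem exists_dyadic_between {x y : ℚ} (hx : 0 ≤ x) (hxy : x < y) :
    ∃ c, 2 ≤ c.unpair.2 ∧ x < dyadic c ∧ dyadic c < y := by
  obtain ⟨m, hm⟩ := pow_unbounded_of_one_lt (2 / (y - x)) (one_lt_two (α := ℚ))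
  have hm' : 2 / (y - x) < 2 ^ (m + 2) := hm.trans_le (pow_le_pow_right₀ one_le_two (by omega))
  rw [div_lt_iff₀ (by linarith)] at hm'
  have h0 : 0 ≤ (x * 2 ^ (m + 2) + 1) / 2 := by positivity
  have h₁ := Nat.floor_le h0
  have h₂ := Nat.lt_floor_add_one ((x * 2 ^ (m + 2) + 1) / 2)
  refine ⟨Nat.pair ⌊(x * 2 ^ (m + 2) + 1) / 2⌋₊ (m + 2), by simp, ?_, ?_⟩
  · rw [dyadic, Nat.unpair_pair, lt_div_iff₀ (by positivity)]
    linarith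
  · rw [dyadic, Nat.unpair_pair, div_lt_iff₀ (by positivity)]
    linarith

/-- The points with codes in `A`, ordered by the dyadic rationals they code. -/
def Points (A : Set ℕ) : Type := ↥A

instance (A : Set ℕ) : LinearOrder (Points A) :=
  LinearOrder.lift' (fun a : Points A => dyadic a.1)
    (dyadic_injective.comp Subtype.val_injective)

instance (A : Set ℕ) : Language.order.Structure (Points A) := orderStructure (Points A)

instance (A : Set ℕ) : Language.order.OrderedStructure (Points A) := ⟨fun _ => Iff.rfl⟩

theorem Points.le_iff {A : Set ℕ} (a b : Points A) : a ≤ b ↔ dyadic a.1 ≤ dyadic b.1 := Iff.rfl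

theorem Points.lt_iff {A : Set ℕ} (a b : Points A) : a < b ↔ dyadic a.1 < dyadic b.1 := by
  rw [← not_le, Points.le_iff, not_le]

/-- A set of codes whose points form a dense linear order without endpoints: beyond each of its
points it contains all points of high enough level up to some larger value. -/
structure DenseCarrier (A : Set ℕ) : Prop where
  compl_infinite : (Aᶜ).Infinite
  nonempty : A.Nonempty
  exists_gt : ∀ a ∈ A, ∃ y, dyadic a < y ∧ ∀ c, 2 ≤ c.unpair.2 → dyadic c < y → c ∈ A

namespace DenseCarrier

variable {A B : Set ℕ}

theorem denselyOrdered (h : DenseCarrier A) : DenselyOrdered (Points A) := by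
  refine ⟨fun a b hab => ?_⟩
  obtain ⟨c, hc, hac, hcb⟩ := exists_dyadic_between (dyadic_pos _).le ((Points.lt_iff a b).1 hab)
  obtain ⟨y, hy, hA⟩ := h.exists_gt b.1 b.2
  exact ⟨⟨c, hA c hc (hcb.trans hy)⟩, (Points.lt_iff _ _).2 hac, (Points.lt_iff _ _).2 hcb⟩

theorem noMaxOrder (h : DenseCarrier A) : NoMaxOrder (Points A) := by
  refine ⟨fun a => ?_⟩
  obtain ⟨y, hy, hA⟩ := h.exists_gt a.1 a.2
  obtain ⟨c, hc, hac, hcy⟩ := exists_dyadic_between (dyadic_pos _).le hy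
  exact ⟨⟨c, hA c hc hcy⟩, (Points.lt_iff _ _).2 hac⟩

theorem noMinOrder (h : DenseCarrier A) : NoMinOrder (Points A) := by
  refine ⟨fun a => ?_⟩
  obtain ⟨y, hy, hA⟩ := h.exists_gt a.1 a.2
  obtain ⟨c, hc, -, hca⟩ := exists_dyadic_between le_rfl (dyadic_pos a.1)
  exact ⟨⟨c, hA c hc (hca.trans hy)⟩, (Points.lt_iff _ _).2 hca⟩

theorem nonempty_points (h : DenseCarrier A) : Nonempty (Points A) := h.nonempty.to_subtype

/-- The coded structure of the points of a dense carrier. -/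
def coded (h : DenseCarrier A) : CodedStructure Language.order :=
  ⟨A, h.compl_infinite, inferInstanceAs (Language.order.Structure (Points A))⟩

theorem models_dlo (h : DenseCarrier A) : h.coded.Models Language.order.dlo := by
  have := h.denselyOrdered
  have := h.noMaxOrder
  have := h.noMinOrder
  exact (model_dlo (L := Language.order) (M := Points A)).realize_of_mem

theorem realize_iff (hA : DenseCarrier A) {N : Type} [LinearOrder N] [DenselyOrdered N]
    [NoMaxOrder N] [NoMinOrder N] [Nonempty N] [Language.order.Structure N]
    [Language.order.OrderedStructure N] {k : ℕ} (φ : Language.order.Formula (Fin k))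
    {a : Fin k → Points A} {b : Fin k → N} {w : Fin 0 → N} (hab : SameOrder a b) :
    φ.Realize a ↔ BoundedFormula.Realize φ b w := by
  have := hA.denselyOrdered
  have := hA.noMaxOrder
  have := hA.noMinOrder
  have := hA.nonempty_points
  refine SameOrder.realize_iff φ ?_
  rintro (i | i) (j | j)
  · exact hab i j
  all_goals first | exact i.elim0 | exact j.elim0

theorem elemSub (hA : DenseCarrier A) (hB : DenseCarrier B) (hAB : A ⊆ B) :
    ElemSub hA.coded hB.coded := by
  have := hB.denselyOrdered
  have := hB.noMaxOrder
  have := hB.noMinOrder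
  have := hB.nonempty_points
  exact ⟨hAB, fun k φ a => hA.realize_iff (N := Points B) φ fun i j => Iff.rfl⟩

end DenseCarrier

theorem exists_nat_sameOrder {M : Type} [LinearOrder M] {k : ℕ} (a : Fin k → M) :
    ∃ u : Fin k → ℕ, SameOrder a u := by
  have hlt (i j : Fin k) (h : a i < a j) : (Finset.univ.filter fun m => a m < a i).card <
      (Finset.univ.filter fun m => a m < a j).card := by
    refine Finset.card_lt_card (Finset.ssubset_iff_subset_ne.2 ⟨fun m hm => ?_, fun he => ?_⟩)
    · simp only [Finset.mem_filter, Finset.mem_univ, true_and] at hm ⊢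
      exact hm.trans h
    · have : i ∈ Finset.univ.filter fun m => a m < a i := by rw [he]; simpa using h
      simp at this
  refine ⟨fun i => (Finset.univ.filter fun m => a m < a i).card, fun i j => ?_⟩
  constructor
  · intro h
    rcases h.eq_or_lt with h | h
    · dsimp only
      rw [h]
    · exact (hlt i j h).le
  · intro h
    by_contra hji
    exact absurd (hlt j i (not_le.1 hji)) (not_lt.2 h)

theorem primrec_dyadic_le {A : Type} [Primcodable A] {f h : A → ℕ} (hf : Primrec f)
    (hh : Primrec h) : PrimrecPred fun a => dyadic (f a) ≤ dyadic (h a) := by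
  have hpow : Primrec₂ fun m n : ℕ => m ^ n :=
    Primrec₂.unpaired'.1 Nat.Primrec.pow
  have key {f h : A → ℕ} (hf : Primrec f) (hh : Primrec h) :
      Primrec fun a => (2 * (f a).unpair.1 + 1) * 2 ^ (h a).unpair.2 :=
    Primrec.nat_mul.comp (Primrec.succ.comp (Primrec.nat_mul.comp (Primrec.const 2)
      (Primrec.fst.comp (Primrec.unpair.comp hf))))
      (hpow.comp (Primrec.const 2) (Primrec.snd.comp (Primrec.unpair.comp hh)))
  exact (Primrec.nat_le.comp (key hf hh) (key hh hf)).of_eq fun a => (dyadic_le_iff _ _).symm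

theorem DenseCarrier.mem_elemDiagram_iff (g : GoedelCoding Language.order) {A : Set ℕ}
    (hA : DenseCarrier A) (c : ℕ) : c ∈ elemDiagram g hA.coded ↔ ∃ l U s : List ℕ,
      c = Nat.pair (Nat.pair s.length (Encodable.encode l)) (Encodable.encode s) ∧
      U.length = s.length ∧ (∀ x, x ∈ s → x ∈ A) ∧
      (∀ i j, i < s.length → j < s.length →
        (dyadic (s.getD i 0) ≤ dyadic (s.getD j 0) ↔ U.getD i 0 ≤ U.getD j 0)) ∧
      Derivable (leToken g) (l, U, [], true) := by
  constructor
  · rintro ⟨k, φ, a, rfl, hφ⟩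
    obtain ⟨u, hu⟩ := exists_nat_sameOrder (M := Points A) a
    refine ⟨formulaTokens g φ, List.ofFn u, List.ofFn fun i => (a i : ℕ), ?_, by simp, ?_, ?_, ?_⟩
    · rw [List.length_ofFn]
      rfl
    · intro x hx
      obtain ⟨i, rfl⟩ := List.mem_ofFn.1 hx
      exact (a i).2
    · intro i j hi hj
      rw [List.length_ofFn] at hi hj
      simpa [hi, hj] using! (Points.le_iff _ _).symm.trans (hu ⟨i, hi⟩ ⟨j, hj⟩)
    · refine derivable_of_realize_iff g φ (List.length_ofFn) rfl (iff_of_true rfl ?_)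
      refine (hA.realize_iff φ (b := (ratVal (List.ofFn u) : Fin k → ℚ)) fun i j => ?_).1 hφ
      rw [hu i j]
      simp [ratVal]
  · rintro ⟨l, U, s, rfl, hU, hs, hle, hd⟩
    obtain ⟨φ, rfl, hφ⟩ := (holds_iff g hU rfl).1 hd.holds
    have hget (i : Fin s.length) : s.getD i 0 = s[i] := by simp
    refine ⟨s.length, φ, fun i => ⟨s[i], hs _ (List.getElem_mem i.2)⟩, ?_, ?_⟩
    · rw [formulaCode_eq, tupleCode]
      simp only [Fin.getElem_fin, List.ofFn_getElem]
      rfl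
    · refine (hA.realize_iff φ (b := (ratVal U : Fin s.length → ℚ)) fun i j => ?_).2 (hφ.1 rfl)
      have := hle i j i.2 j.2
      rw [hget, hget] at this
      exact this.trans (Nat.cast_le (α := ℚ)).symm

theorem DenseCarrier.arithDecidable (g : GoedelCoding Language.order) {A : Set ℕ}
    (hA : DenseCarrier A) (h : ArPred ∅ (· ∈ A)) : ArithDecidable g hA.coded := by
  refine arReducible_iff_arPred.2 ?_
  have hl : Primrec fun p : ℕ × List ℕ × List ℕ × List ℕ => p.2.1 := Primrec.fst.comp Primrec.snd
  have hU : Primrec fun p : ℕ × List ℕ × List ℕ × List ℕ => p.2.2.1 :=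
    Primrec.fst.comp (Primrec.snd.comp Primrec.snd)
  have hs : Primrec fun p : ℕ × List ℕ × List ℕ × List ℕ => p.2.2.2 :=
    Primrec.snd.comp (Primrec.snd.comp Primrec.snd)
  refine (ArPred.exists (B := List ℕ × List ℕ × List ℕ) (p := fun c y =>
    c = Nat.pair (Nat.pair y.2.2.length (Encodable.encode y.1)) (Encodable.encode y.2.2) ∧
      y.2.1.length = y.2.2.length ∧ (∀ x, x ∈ y.2.2 → x ∈ A) ∧
      (∀ i j, i < y.2.2.length → j < y.2.2.length →
        (dyadic (y.2.2.getD i 0) ≤ dyadic (y.2.2.getD j 0) ↔ y.2.1.getD i 0 ≤ y.2.1.getD j 0)) ∧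
      Derivable (leToken g) (y.1, y.2.1, [], true)) ?_).of_iff
    fun c => by simp only [Prod.exists, hA.mem_elemDiagram_iff]
  refine .and (.eq Primrec.fst (Primrec₂.natPair.comp (Primrec₂.natPair.comp
    (Primrec.list_length.comp hs) (Primrec.encode.comp hl)) (Primrec.encode.comp hs)))
    (.and (.eq (Primrec.list_length.comp hU) (Primrec.list_length.comp hs))
      (.and (.forall (.imp (.mem_list Primrec.snd (hs.comp Primrec.fst)) (h.comp Primrec.snd)))
        (.and (.forall (.forall ?_))
          (.derivable _ (hl.pair (hU.pair (Primrec.const ([], true))))))))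
  have hi : Primrec fun p : ((ℕ × List ℕ × List ℕ × List ℕ) × ℕ) × ℕ => p.1.2 :=
    Primrec.snd.comp Primrec.fst
  have hj : Primrec fun p : ((ℕ × List ℕ × List ℕ × List ℕ) × ℕ) × ℕ => p.2 := Primrec.snd
  have hs' := hs.comp ((Primrec.fst (α := ℕ × List ℕ × List ℕ × List ℕ) (β := ℕ)).comp
    (Primrec.fst (β := ℕ)))
  have hU' := hU.comp ((Primrec.fst (α := ℕ × List ℕ × List ℕ × List ℕ) (β := ℕ)).comp
    (Primrec.fst (β := ℕ)))
  exact .imp (.lt hi (Primrec.list_length.comp hs')) (.imp (.lt hj (Primrec.list_length.comp hs'))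
    (.iff (.of_primrecPred (primrec_dyadic_le ((Primrec.list_getD 0).comp hs' hi)
        ((Primrec.list_getD 0).comp hs' hj)))
      (.of_primrecPred (Primrec.nat_le.comp ((Primrec.list_getD 0).comp hU' hi)
        ((Primrec.list_getD 0).comp hU' hj)))))

end DyadicPoints

section Counterexample

/-- The carrier of the ambient decidable model. -/
def bigCarrier : Set ℕ := {c | 0 < c.unpair.2 ∨ c.unpair.1 = 0}

/-- The carrier of the common elementary substructure, with points below `1`. -/
def baseCarrier : Set ℕ := {c | 1 < c.unpair.2 ∧ dyadic c < dyadic 0}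

/-- All points of level at least two, with `d` coded in the points of level one. -/
def codingCarrier (d : Set ℕ) : Set ℕ := {c | 1 < c.unpair.2 ∨ c.unpair.2 = 1 ∧ c.unpair.1 ∈ d}

theorem compl_infinite_of_subset_bigCarrier {A : Set ℕ} (hA : A ⊆ bigCarrier) :
    (Aᶜ).Infinite := by
  refine Set.infinite_of_injective_forall_mem (f := fun p => Nat.pair (p + 1) 0)
    (fun p q h => by simpa [Nat.pair_eq_pair] using h) fun p hp => ?_
  simpa [bigCarrier] using hA hp

theorem DenseCarrier.of_subset {A : Set ℕ} (h : ∀ c, 1 < c.unpair.2 → c ∈ A)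
    (hA : A ⊆ bigCarrier) : DenseCarrier A :=
  ⟨compl_infinite_of_subset_bigCarrier hA, ⟨Nat.pair 0 2, h _ (by simp)⟩, fun a _ =>
    ⟨dyadic a + 1, lt_add_one _, fun c hc _ => h c hc⟩⟩

theorem dense_bigCarrier : DenseCarrier bigCarrier :=
  .of_subset (fun _ hc => Or.inl (zero_lt_one.trans hc)) subset_rfl

theorem dense_baseCarrier : DenseCarrier baseCarrier := by
  refine ⟨compl_infinite_of_subset_bigCarrier fun c hc => Or.inl (zero_lt_one.trans hc.1), ?_,
    fun a ha => ⟨dyadic 0, ha.2, fun c hc h => ⟨hc, h⟩⟩⟩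
  obtain ⟨c, hc, -, h⟩ := exists_dyadic_between le_rfl (dyadic_pos 0)
  exact ⟨c, hc, h⟩

theorem codingCarrier_subset (d : Set ℕ) : codingCarrier d ⊆ bigCarrier :=
  fun c hc => Or.inl (by rcases hc with hc | hc <;> omega)

theorem insert_codingCarrier_subset (d : Set ℕ) : insert 0 (codingCarrier d) ⊆ bigCarrier :=
  Set.insert_subset (Or.inr (by simp)) (codingCarrier_subset d)

theorem dense_codingCarrier (d : Set ℕ) : DenseCarrier (codingCarrier d) :=
  .of_subset (fun _ hc => Or.inl hc) (codingCarrier_subset d)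

theorem dense_insert_codingCarrier (d : Set ℕ) : DenseCarrier (insert 0 (codingCarrier d)) :=
  .of_subset (fun _ hc => Or.inr (Or.inl hc)) (insert_codingCarrier_subset d)

theorem baseCarrier_subset (d : Set ℕ) : baseCarrier ⊆ codingCarrier d := fun _ hc => Or.inl hc.1

theorem primrec_unpair_fst : Primrec fun c : ℕ => c.unpair.1 := Primrec.fst.comp Primrec.unpair

theorem primrec_unpair_snd : Primrec fun c : ℕ => c.unpair.2 := Primrec.snd.comp Primrec.unpair

theorem arPred_mem_bigCarrier : ArPred ∅ (· ∈ bigCarrier) :=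
  .or (.lt (Primrec.const 0) primrec_unpair_snd) (.eq primrec_unpair_fst (Primrec.const 0))

theorem arPred_mem_baseCarrier : ArPred ∅ (· ∈ baseCarrier) :=
  .and (.lt (Primrec.const 1) primrec_unpair_snd)
    ((ArPred.not (.of_primrecPred (primrec_dyadic_le (Primrec.const 0) Primrec.id))).of_iff
      fun _ => not_le)

theorem arPred_mem_codingCarrier (d : Set ℕ) : ArPred d (· ∈ codingCarrier d) :=
  .or (.lt (Primrec.const 1) primrec_unpair_snd)
    (.and (.eq primrec_unpair_snd (Primrec.const 1)) (.mem_oracle primrec_unpair_fst))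

theorem arReducible_of_pair_mem_iff {d A : Set ℕ} (h : ∀ p, Nat.pair p 1 ∈ A ↔ p ∈ d) :
    ArReducible d A :=
  arReducible_iff_arPred.2 ((ArPred.mem_oracle (Primrec₂.natPair.comp Primrec.id
    (Primrec.const 1))).of_iff h)

theorem arEquiv_codingCarrier (d : Set ℕ) : ArEquiv (codingCarrier d) d :=
  ⟨arReducible_iff_arPred.2 (arPred_mem_codingCarrier d),
    arReducible_of_pair_mem_iff fun p => by simp [codingCarrier]⟩

theorem arEquiv_insert_codingCarrier (d : Set ℕ) :
    ArEquiv (insert 0 (codingCarrier d)) d := by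
  refine ⟨arReducible_iff_arPred.2 (.or (.eq Primrec.id (Primrec.const 0))
    (arPred_mem_codingCarrier d)), arReducible_of_pair_mem_iff fun p => ?_⟩
  have : Nat.pair p 1 ≠ 0 := fun h => by
    have := congrArg (fun c => (Nat.unpair c).2) h
    simp at this
  simp [codingCarrier, this]

theorem DenseCarrier.arithExtendible (g : GoedelCoding Language.order) {A : Set ℕ}
    (hA : DenseCarrier A) (h : A ⊆ bigCarrier) : ArithExtendible g Language.order.dlo hA.coded :=
  ⟨dense_bigCarrier.coded, dense_bigCarrier.arithDecidable g arPred_mem_bigCarrier,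
    dense_bigCarrier.models_dlo, hA.elemSub dense_bigCarrier h⟩

theorem CodedIso.dyadic_lt_iff {A B : Set ℕ} {hA : DenseCarrier A} {hB : DenseCarrier B}
    (f : CodedIso hA.coded hB.coded) (a b : ↥A) :
    dyadic (f.toFun a).1 < dyadic (f.toFun b).1 ↔ dyadic a.1 < dyadic b.1 := by
  have h : dyadic b.1 ≤ dyadic a.1 ↔ dyadic (f.toFun b).1 ≤ dyadic (f.toFun a).1 :=
    f.map_rel (leSymb : Language.order.Relations 2) (![b, a] : Fin 2 → ↥A)
  rw [← not_le, ← not_le, h]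

/-- A point of a carrier omitting `0` which lies above all points of the base carrier is larger
than the point coded by `0`. -/
theorem dyadic_zero_lt_of_forall {x : ℕ} (hx : x ≠ 0)
    (h : ∀ c ∈ baseCarrier, dyadic c < dyadic x) : dyadic 0 < dyadic x := by
  by_contra hlt
  have hlt : dyadic x < dyadic 0 := lt_of_le_of_ne (not_lt.1 hlt) (dyadic_injective.ne hx)
  obtain ⟨c, hc, hxc, hc0⟩ := exists_dyadic_between (dyadic_pos x).le hlt
  exact lt_asymm hxc (h c ⟨hc, hc0⟩)

theorem zero_notMem_codingCarrier (d : Set ℕ) : 0 ∉ codingCarrier d := by simp [codingCarrier]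

theorem not_exists_iso_fixing_base (d : Set ℕ)
    (f : CodedIso (dense_insert_codingCarrier d).coded (dense_codingCarrier d).coded)
    (hf : ∀ (x : ℕ) (_ : x ∈ baseCarrier) (h₁ : x ∈ insert 0 (codingCarrier d)),
      (f.toFun ⟨x, h₁⟩ : ℕ) = x) : False := by
  have hne (y : ↥(codingCarrier d)) : y.1 ≠ 0 :=
    fun h => zero_notMem_codingCarrier d (h ▸ y.2)
  have hbase (b : ↥(insert 0 (codingCarrier d))) :
      (∀ c ∈ baseCarrier, dyadic c < dyadic (f.toFun b).1) ↔
        ∀ c ∈ baseCarrier, dyadic c < dyadic b.1 := by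
    refine forall₂_congr fun c hc => ?_
    have hc' : c ∈ insert 0 (codingCarrier d) := Or.inr (baseCarrier_subset d hc)
    exact (iff_of_eq (congrArg (fun x => dyadic x < dyadic (f.toFun b).1) (hf c hc hc'))).symm.trans
      (f.dyadic_lt_iff ⟨c, hc'⟩ b)
  have h0 : (0 : ℕ) ∈ insert 0 (codingCarrier d) := Or.inl rfl
  have hy := dyadic_zero_lt_of_forall (hne (f.toFun ⟨0, h0⟩)) ((hbase ⟨0, h0⟩).2 fun c hc => hc.2)
  obtain ⟨z, hz, h0z, hzy⟩ := exists_dyadic_between (dyadic_pos 0).le hy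
  have hzd : z ∈ codingCarrier d := Or.inl hz
  set b := f.invFun ⟨z, hzd⟩ with hb
  have hfb : f.toFun b = ⟨z, hzd⟩ := f.right_inv _
  have hb0 : dyadic b.1 < dyadic 0 := by
    rw [← f.dyadic_lt_iff b ⟨0, h0⟩, hfb]
    exact hzy
  have hb1 := (hbase b).1 (by rw [hfb]; exact fun c hc => hc.2.trans h0z)
  have hb2 := dyadic_zero_lt_of_forall (fun h => by simp [h] at hb0) hb1
  exact lt_asymm hb0 hb2

end Counterexample

/-- **`DLO` is not `D`-categorical** for any nonzero arithmetic degree `D`. -/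
theorem dlo_not_D_categorical
    (g : GoedelCoding Language.order) (hL : ArithLang g)
    (hT : ArithTheory g Language.order.dlo)
    (d : Set ℕ) (hd : ¬ IsArithmetical d) :
    ¬ DCategorical g Language.order.dlo d := by
  intro h
  obtain ⟨f, -, hf⟩ := h dense_baseCarrier.coded (dense_insert_codingCarrier d).coded
    (dense_codingCarrier d).coded (dense_baseCarrier.arithDecidable g arPred_mem_baseCarrier)
    dense_baseCarrier.models_dlo (dense_insert_codingCarrier d).models_dlo
    ((dense_insert_codingCarrier d).arithExtendible g (insert_codingCarrier_subset d))
    (dense_codingCarrier d).models_dlo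
    ((dense_codingCarrier d).arithExtendible g (codingCarrier_subset d))
    (dense_baseCarrier.elemSub _ ((baseCarrier_subset d).trans (Set.subset_insert _ _)))
    (dense_baseCarrier.elemSub _ (baseCarrier_subset d))
    (arEquiv_insert_codingCarrier d) (arEquiv_codingCarrier d)
  exact not_exists_iso_fixing_base d f hf

end ArMorley
end

section
/- Let M be an infinite L-structure, let X ⊆ M be infinite, and fix N < ω. Let 𝒯 be a finite set of pairs (i, t), where i < N and t = t(x₀, …, x̂ᵢ, …, x_{N−1}) is an L-term in the variables x₀, …, x_{N−1} not involving the variable xᵢ. Then there exist elements a₀, …, a_{N−1} ∈ X such that for every (i, t) ∈ 𝒯, aᵢ ≠ t^M(a₀, …, âᵢ, …, a_{N−1}). -/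
open FirstOrder FirstOrder.Language

namespace ArMorley

variable {L : FirstOrder.Language}

/-- Over a finite index set, finitely many conditions `a i = f (a restricted to j ≠ i)` can be
simultaneously avoided by a tuple from any infinite set. -/
theorem exists_forall_ne_of_infinite {ι κ M : Type*} [Fintype ι] {X : Set M} (hX : X.Infinite)
    (T : Finset κ) (i : κ → ι) (f : (q : κ) → ({ j : ι // j ≠ i q } → M) → M) :
    ∃ a : ι → M, (∀ k, a k ∈ X) ∧ ∀ q ∈ T, a (i q) ≠ f q (fun j => a j.1) := by
  classical
  obtain ⟨S, hSX, hS⟩ := hX.exists_subset_card_eq (T.card + 1)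
  by_contra! hbad
  let P : Finset (ι → M) := Fintype.piFinset fun _ => S
  have hcover : P ⊆ T.biUnion fun q => {a ∈ P | a (i q) = f q fun j => a j.1} := by
    intro a ha
    have hamem : ∀ k, a k ∈ S := Fintype.mem_piFinset.1 ha
    obtain ⟨q, hq, h⟩ := hbad a fun k => hSX (hamem k)
    exact Finset.mem_biUnion.2 ⟨q, hq, Finset.mem_filter.2 ⟨ha, h⟩⟩
  have hfiber : ∀ q ∈ T,
      ({a ∈ P | a (i q) = f q fun j => a j.1} : Finset (ι → M)).card ≤
        (T.card + 1) ^ (Fintype.card ι - 1) := by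
    intro q _
    have hcard : (Fintype.piFinset fun _ : { j : ι // j ≠ i q } => S).card =
        (T.card + 1) ^ (Fintype.card ι - 1) := by
      rw [Fintype.card_piFinset, Finset.prod_const, Finset.card_univ, hS,
        Fintype.card_subtype_compl, Fintype.card_subtype_eq]
    rw [← hcard]
    refine Finset.card_le_card_of_injOn (fun a j => a j.1) ?_ ?_
    · intro a ha
      have hamem : ∀ k, a k ∈ S := Fintype.mem_piFinset.1 (Finset.mem_filter.1 ha).1
      exact Fintype.mem_piFinset.2 fun j => hamem j
    · intro a ha b hb hab
      funext k
      by_cases hk : k = i q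
      · subst hk
        rw [(Finset.mem_filter.1 ha).2, (Finset.mem_filter.1 hb).2]
        exact congrArg (f q) hab
      · exact congrFun hab ⟨k, hk⟩
  have hle := (Finset.card_le_card hcover).trans (Finset.card_biUnion_le_card_mul _ _ _ hfiber)
  rw [Fintype.card_piFinset, Finset.prod_const, Finset.card_univ, hS] at hle
  rcases isEmpty_or_nonempty ι with hι | hι
  · have : IsEmpty κ := ⟨fun q => hι.elim (i q)⟩
    simp [Finset.eq_empty_of_isEmpty T] at hle
  · obtain ⟨n, hn⟩ := Nat.exists_eq_succ_of_ne_zero (Fintype.card_ne_zero (α := ι))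
    rw [hn, Nat.succ_sub_one, Nat.pow_succ'] at hle
    exact absurd (Nat.le_of_mul_le_mul_right hle (by positivity)) (by simp)

/-- **Finite Skolem avoidance.** -/
theorem finite_skolem_avoidance
    {L : FirstOrder.Language} {M : Type*} (SM : L.Structure M)
    (hM : Infinite M) (X : Set M) (hX : X.Infinite) (N : ℕ)
    (𝒯 : Set ((i : Fin N) × L.Term { j : Fin N // j ≠ i })) (h𝒯 : 𝒯.Finite) :
    ∃ a : Fin N → M, (∀ i, a i ∈ X) ∧
      ∀ q ∈ 𝒯, a q.1 ≠ (letI := SM; q.2.realize (fun j => a j.1)) := by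
  obtain ⟨a, ha, h⟩ := exists_forall_ne_of_infinite hX h𝒯.toFinset (fun q => q.1)
    (fun q v => letI := SM; q.2.realize v)
  exact ⟨a, ha, fun q hq => h q (h𝒯.mem_toFinset.2 hq)⟩

end ArMorley
end
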